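/- arXiv:2509.18202 — 3 statements merged into one kernel-verified Lean document; each statement's English description precedes it below -/
import Mathlib

section
/- Let 0 < ρ < 1/3, ρ < λ < (1−ρ)/2, and let E be the attractor of {φ₁(x)=ρx, φ₂(x)=ρx+λ, φ₃(x)=ρx+1−ρ}. Then for every 0 < r < 1 and every t ∈ ℝ, the set −r(φ₁(E) ∪ φ₂(E)) + t is not contained in E. -/
/-- `E ⊆ [0, 1]` is a compact set containing `0` and `1` which is the union of its images under
`x ↦ ρ x`, `x ↦ ρ x + lam` and `x ↦ ρ x + 1 - ρ`, where the first gap is the shorter one. -/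
structure IsThreeMapAttractor (ρ lam : ℝ) (E : Set ℝ) : Prop where
  rho_pos : 0 < ρ
  rho_lt : ρ < 1 / 3
  rho_lt_lam : ρ < lam
  lam_lt : lam < (1 - ρ) / 2
  isCompact : IsCompact E
  nonneg : ∀ x ∈ E, 0 ≤ x
  le_one : ∀ x ∈ E, x ≤ 1
  zero_mem : (0 : ℝ) ∈ E
  one_mem : (1 : ℝ) ∈ E
  image_mem : ∀ d, d = 0 ∨ d = lam ∨ d = 1 - ρ → ∀ x ∈ E, d + ρ * x ∈ E
  exists_preimage : ∀ x ∈ E, ∃ d, (d = 0 ∨ d = lam ∨ d = 1 - ρ) ∧ ∃ y ∈ E, x = d + ρ * y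

/-- `IsOffset ρ lam k b` says that `x ↦ b + ρ ^ k * x` is a composition of `k` of the maps
`x ↦ ρ x`, `x ↦ ρ x + lam`, `x ↦ ρ x + 1 - ρ`. -/
inductive IsOffset (ρ lam : ℝ) : ℕ → ℝ → Prop
  | zero : IsOffset ρ lam 0 0
  | step {k : ℕ} {b d : ℝ} : IsOffset ρ lam k b → (d = 0 ∨ d = lam ∨ d = 1 - ρ) →
      IsOffset ρ lam (k + 1) (b + ρ ^ k * d)

/-- Every finite subset of `A` whose points are pairwise more than `δ` apart has at most `N`
elements. -/
def PackingLE (A : Set ℝ) (δ : ℝ) (N : ℕ) : Prop :=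
  ∀ S : Finset ℝ, (S : Set ℝ) ⊆ A → (∀ x ∈ S, ∀ y ∈ S, x ≠ y → δ < |x - y|) → S.card ≤ N

lemma PackingLE.union {A B : Set ℝ} {δ : ℝ} {M N : ℕ} (hA : PackingLE A δ M)
    (hB : PackingLE B δ N) : PackingLE (A ∪ B) δ (M + N) := by
  classical
  intro S hS hsep
  have h1 := hA (S.filter (· ∈ A)) (fun x hx => by simpa using (Finset.mem_filter.1 hx).2)
    (fun x hx y hy => hsep x (Finset.mem_filter.1 hx).1 y (Finset.mem_filter.1 hy).1)
  have h2 := hB (S.filter (· ∉ A))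
    (fun x hx => by
      have hx' := Finset.mem_filter.1 hx
      exact (hS hx'.1).resolve_left hx'.2)
    (fun x hx y hy => hsep x (Finset.mem_filter.1 hx).1 y (Finset.mem_filter.1 hy).1)
  have h3 := Finset.card_filter_add_card_filter_not (s := S) (· ∈ A)
  omega

lemma PackingLE.mono {A B : Set ℝ} {δ : ℝ} {N : ℕ} (hB : PackingLE B δ N) (h : A ⊆ B) :
    PackingLE A δ N :=
  fun S hS hsep => hB S (hS.trans h) hsep

lemma PackingLE.of_subset_Icc {A : Set ℝ} {a δ : ℝ} (h : A ⊆ Set.Icc a (a + δ)) :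
    PackingLE A δ 1 := by
  intro S hS hsep
  refine Finset.card_le_one.2 fun x hx y hy => ?_
  by_contra hne
  have h1 := h (hS hx)
  have h2 := h (hS hy)
  have h3 := hsep x hx y hy hne
  have h4 : |x - y| ≤ δ := abs_le.2 ⟨by linarith [h1.1, h2.2], by linarith [h1.2, h2.1]⟩
  linarith

namespace IsThreeMapAttractor

variable {ρ lam : ℝ} {E : Set ℝ}

lemma of_eq_union (hρ0 : 0 < ρ) (hρ3 : ρ < 1 / 3) (hl1 : ρ < lam) (hl2 : lam < (1 - ρ) / 2)
    (hEc : IsCompact E) (hEne : E.Nonempty)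
    (hE : E = (fun x : ℝ => ρ * x) '' E ∪ (fun x : ℝ => ρ * x + lam) '' E ∪
        (fun x : ℝ => ρ * x + (1 - ρ)) '' E) : IsThreeMapAttractor ρ lam E := by
  have himage : ∀ d, d = 0 ∨ d = lam ∨ d = 1 - ρ → ∀ x ∈ E, d + ρ * x ∈ E := by
    intro d hd x hx
    rw [hE]
    rcases hd with rfl | rfl | rfl
    · exact Or.inl (Or.inl ⟨x, hx, by ring⟩)
    · exact Or.inl (Or.inr ⟨x, hx, by ring⟩)
    · exact Or.inr ⟨x, hx, by ring⟩
  have hpre : ∀ x ∈ E, ∃ d, (d = 0 ∨ d = lam ∨ d = 1 - ρ) ∧ ∃ y ∈ E, x = d + ρ * y := by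
    intro x hx
    rw [hE] at hx
    rcases hx with (⟨y, hy, rfl⟩ | ⟨y, hy, rfl⟩) | ⟨y, hy, rfl⟩
    · exact ⟨0, by simp, y, hy, by ring⟩
    · exact ⟨lam, by simp, y, hy, by ring⟩
    · exact ⟨1 - ρ, by simp, y, hy, by ring⟩
  obtain ⟨u, hu, humin⟩ := hEc.exists_isLeast hEne
  obtain ⟨v, hv, hvmax⟩ := hEc.exists_isGreatest hEne
  have hu0 : u = 0 := by
    obtain ⟨d, hd, y, hy, hxy⟩ := hpre u hu
    have h1 := humin hy
    have h2 := humin (himage 0 (by simp) u hu)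
    have hd0 : 0 ≤ d := by rcases hd with rfl | rfl | rfl <;> linarith
    apply le_antisymm <;> nlinarith
  have hv1 : v = 1 := by
    obtain ⟨d, hd, y, hy, hxy⟩ := hpre v hv
    have h1 := hvmax hy
    have h2 := hvmax (himage (1 - ρ) (by simp) v hv)
    have hd0 : d ≤ 1 - ρ := by rcases hd with rfl | rfl | rfl <;> linarith
    apply le_antisymm <;> nlinarith
  subst hu0 hv1
  exact ⟨hρ0, hρ3, hl1, hl2, hEc, fun x hx => humin hx, fun x hx => hvmax hx, hu, hv,
    himage, hpre⟩

lemma pow_mul_mem (h : IsThreeMapAttractor ρ lam E) {x : ℝ} (hx : x ∈ E) (i : ℕ) :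
    ρ ^ i * x ∈ E := by
  induction i with
  | zero => simpa using hx
  | succ i ih =>
    have := h.image_mem 0 (by simp) _ ih
    rwa [zero_add, ← mul_assoc, ← pow_succ'] at this

lemma exists_mem_Ioc_add (h : IsThreeMapAttractor ρ lam E) (n : ℕ) :
    ∀ y : ℝ, 0 ≤ y → y < 1 → ∃ x ∈ E, y < x ∧ x ≤ y + (1 - 2 * ρ - lam) + ρ ^ n := by
  have hρ := h.rho_pos
  have hρ3 := h.rho_lt
  have hl1 := h.rho_lt_lam
  have hl2 := h.lam_lt
  induction n with
  | zero => exact fun y h0 h1 => ⟨1, h.one_mem, h1, by simp; linarith⟩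
  | succ n ih =>
    have hpow : 0 < ρ ^ (n + 1) := pow_pos hρ _
    have key : ∀ d, d = 0 ∨ d = lam ∨ d = 1 - ρ → ∀ y : ℝ, d ≤ y → y < d + ρ →
        ∃ x ∈ E, y < x ∧ x ≤ y + (1 - 2 * ρ - lam) + ρ ^ (n + 1) := by
      intro d hd y hy1 hy2
      obtain ⟨x, hx, h1, h2⟩ := ih ((y - d) / ρ) (div_nonneg (by linarith) hρ.le)
        ((div_lt_one hρ).2 (by linarith))
      refine ⟨d + ρ * x, h.image_mem d hd x hx, ?_, ?_⟩
      · have := (div_lt_iff₀ hρ).1 h1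
        linarith
      · have h3 := mul_le_mul_of_nonneg_left h2 hρ.le
        have h4 : ρ * ((y - d) / ρ + (1 - 2 * ρ - lam) + ρ ^ n) =
            (y - d) + ρ * (1 - 2 * ρ - lam) + ρ ^ (n + 1) := by
          field_simp
          ring
        nlinarith
    have hlam : lam ∈ E := by simpa using h.image_mem lam (by simp) 0 h.zero_mem
    have hlast : 1 - ρ ∈ E := by simpa using h.image_mem (1 - ρ) (by simp) 0 h.zero_mem
    intro y h0 h1
    rcases lt_or_ge y ρ with c1 | c1
    · exact key 0 (by simp) y h0 (by linarith)
    rcases lt_or_ge y lam with c2 | c2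
    · exact ⟨lam, hlam, c2, by linarith⟩
    rcases lt_or_ge y (lam + ρ) with c3 | c3
    · exact key lam (by simp) y c2 c3
    rcases lt_or_ge y (1 - ρ) with c4 | c4
    · exact ⟨1 - ρ, hlast, c4, by linarith⟩
    · exact key (1 - ρ) (by simp) y c4 (by linarith)

/-- The ratio of the endpoints of a gap of `E` is less than `(1 - lam - ρ) / ρ`. -/
lemma exists_mem_Ioo_mul (h : IsThreeMapAttractor ρ lam E) {y : ℝ} (hy0 : 0 < y) (hy1 : y < 1) :
    ∃ x ∈ E, y < x ∧ x * ρ < y * (1 - lam - ρ) := by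
  have hρ := h.rho_pos
  have hρ3 := h.rho_lt
  have hl1 := h.rho_lt_lam
  have hl2 := h.lam_lt
  have key : ∀ y : ℝ, ρ ≤ y → y < 1 → ∃ x ∈ E, y < x ∧ x * ρ < y * (1 - lam - ρ) := by
    intro y h0 h1
    rcases lt_or_ge y lam with c | c
    · exact ⟨lam, by simpa using h.image_mem lam (by simp) 0 h.zero_mem, c, by nlinarith⟩
    · obtain ⟨n, hn⟩ := exists_pow_lt_of_lt_one
        (show 0 < (lam - ρ) * (1 - 2 * ρ - lam) / ρ from
          div_pos (mul_pos (by linarith) (by linarith)) hρ) (show ρ < 1 by linarith)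
      obtain ⟨x, hx, h2, h3⟩ := h.exists_mem_Ioc_add n y (by linarith) h1
      refine ⟨x, hx, h2, ?_⟩
      rw [lt_div_iff₀ hρ] at hn
      have h4 := mul_le_mul_of_nonneg_right h3 hρ.le
      nlinarith
  obtain ⟨i, hi1, hi2⟩ := exists_nat_pow_near_of_lt_one hy0 hy1.le hρ (by linarith)
  rcases hi2.lt_or_eq with hi2 | hi2
  · have hp : 0 < ρ ^ i := pow_pos hρ i
    obtain ⟨x, hx, h1, h2⟩ := key (y / ρ ^ i)
      ((le_div_iff₀ hp).2 (by rw [← pow_succ']; exact hi1.le)) ((div_lt_one hp).2 hi2)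
    refine ⟨ρ ^ i * x, h.pow_mul_mem hx i, ?_, ?_⟩
    · rw [div_lt_iff₀ hp] at h1
      linarith
    · have h3 := mul_lt_mul_of_pos_left h2 hp
      have h4 : ρ ^ i * (y / ρ ^ i * (1 - lam - ρ)) = y * (1 - lam - ρ) := by
        field_simp
      linarith
  · obtain ⟨i, rfl⟩ : ∃ j, i = j + 1 := Nat.exists_eq_succ_of_ne_zero (by
      rintro rfl
      simp at hi2
      linarith)
    have hp : 0 < ρ ^ i := pow_pos hρ i
    obtain ⟨x, hx, h1, h2⟩ := key ρ le_rfl (by linarith)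
    refine ⟨ρ ^ i * x, h.pow_mul_mem hx i, ?_, ?_⟩
    · rw [hi2, pow_succ]
      exact mul_lt_mul_of_pos_left h1 hp
    · rw [hi2, pow_succ]
      nlinarith [mul_lt_mul_of_pos_left h2 hp]

lemma one_sub_notMem (h : IsThreeMapAttractor ρ lam E) (j : ℕ) :
    ∀ p : ℝ, ρ ^ j * ρ < p → p < ρ ^ j * (1 - lam - ρ) → 1 - p ∉ E := by
  have hρ := h.rho_pos
  have hρ3 := h.rho_lt
  have hl1 := h.rho_lt_lam
  have hl2 := h.lam_lt
  induction j with
  | zero =>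
    intro p h1 h2 hp
    simp only [pow_zero, one_mul] at h1 h2
    obtain ⟨d, hd, y, hy, hxy⟩ := h.exists_preimage _ hp
    have := h.nonneg y hy
    have := h.le_one y hy
    rcases hd with rfl | rfl | rfl <;> nlinarith
  | succ j ih =>
    intro p h1 h2 hp
    have hj : ρ ^ j ≤ 1 := pow_le_one₀ hρ.le (by linarith)
    rw [pow_succ'] at h1 h2
    have hpρ : p < ρ := by
      have : ρ * ρ ^ j * (1 - lam - ρ) ≤ ρ * 1 * 1 := by
        gcongr <;> linarith
      linarith
    obtain ⟨d, hd, y, hy, hxy⟩ := h.exists_preimage _ hp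
    have := h.nonneg y hy
    have := h.le_one y hy
    have hd : d = 1 - ρ := by
      rcases hd with rfl | rfl | rfl
      · nlinarith
      · nlinarith
      · rfl
    subst hd
    have hpy : p = ρ * (1 - y) := by linarith
    refine ih (1 - y) ?_ ?_ (by simpa using hy)
    · refine lt_of_mul_lt_mul_left (a := ρ) ?_ hρ.le
      linarith
    · refine lt_of_mul_lt_mul_left (a := ρ) ?_ hρ.le
      linarith

/-- A reflected copy of `E` of ratio `κ` inside `E` has right endpoint at a definite distance
from `1`. -/
lemma not_reflect_near_one (h : IsThreeMapAttractor ρ lam E) {κ ε : ℝ} {j : ℕ} (hκ : ρ ^ j ≤ κ)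
    (hε0 : 0 ≤ ε) (hε : ε ≤ ρ ^ (j + 2)) : ¬ ∀ x ∈ E, 1 - ε - κ * x ∈ E := by
  have hρ := h.rho_pos
  have hρ3 := h.rho_lt
  have hl1 := h.rho_lt_lam
  have hl2 := h.lam_lt
  intro hsub
  have hp : 0 < ρ ^ j := pow_pos hρ j
  have hκ0 : 0 < κ := by linarith
  have hε1 : ε < ρ ^ j * ρ := by
    have : ρ ^ (j + 2) = ρ ^ j * ρ * ρ := by ring
    nlinarith [mul_pos hp hρ]
  obtain ⟨x, hx, h1, h2⟩ := h.exists_mem_Ioo_mul (y := (ρ ^ j * ρ - ε) / κ)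
    (div_pos (by linarith) hκ0) ((div_lt_one hκ0).2 (by nlinarith))
  rw [div_lt_iff₀ hκ0] at h1
  rw [div_mul_eq_mul_div, lt_div_iff₀ hκ0] at h2
  refine h.one_sub_notMem j (ε + κ * x) (by linarith) ?_ (by
    have := hsub x hx
    rwa [sub_sub] at this)
  have h3 : ρ * (κ * x + ε) < ρ * (ρ ^ j * (1 - lam - ρ)) := by
    nlinarith
  have := lt_of_mul_lt_mul_left h3 hρ.le
  linarith

lemma offset_mem (h : IsThreeMapAttractor ρ lam E) {k : ℕ} {b : ℝ} (hb : IsOffset ρ lam k b) :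
    ∀ x ∈ E, b + ρ ^ k * x ∈ E := by
  induction hb with
  | zero => intro x hx; simpa using hx
  | @step k b d _ hd ih =>
    intro x hx
    have := ih _ (h.image_mem d hd x hx)
    convert this using 1
    ring

lemma exists_offset (h : IsThreeMapAttractor ρ lam E) (k : ℕ) :
    ∀ x ∈ E, ∃ b, IsOffset ρ lam k b ∧ ∃ y ∈ E, x = b + ρ ^ k * y := by
  induction k with
  | zero => exact fun x hx => ⟨0, .zero, x, hx, by simp⟩
  | succ k ih =>
    intro x hx
    obtain ⟨b, hb, y, hy, rfl⟩ := ih x hx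
    obtain ⟨d, hd, z, hz, rfl⟩ := h.exists_preimage y hy
    exact ⟨_, hb.step hd, z, hz, by ring⟩

lemma offset_separated (h : IsThreeMapAttractor ρ lam E) {k : ℕ} {b : ℝ}
    (hb : IsOffset ρ lam k b) :
    (∀ x ∈ E, b ≤ x → x ≤ b + ρ ^ k → ∃ y ∈ E, x = b + ρ ^ k * y) ∧
      ∀ x ∈ E, b + ρ ^ k < x → b + ρ ^ k + ρ ^ k * (lam - ρ) ≤ x := by
  have hρ := h.rho_pos
  have hρ3 := h.rho_lt
  have hl1 := h.rho_lt_lam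
  have hl2 := h.lam_lt
  induction hb with
  | zero =>
    refine ⟨fun x hx _ _ => ⟨x, hx, by simp⟩, fun x hx h1 => ?_⟩
    have := h.le_one x hx
    simp at h1
    linarith
  | @step k b d _ hd ih =>
    have hp : 0 < ρ ^ k := pow_pos hρ k
    have hd0 : 0 ≤ d := by rcases hd with rfl | rfl | rfl <;> linarith
    have hd1 : d ≤ 1 - ρ := by rcases hd with rfl | rfl | rfl <;> linarith
    refine ⟨fun x hx h1 h2 => ?_, fun x hx h1 => ?_⟩
    · rw [pow_succ] at h2
      obtain ⟨y, hy, rfl⟩ := ih.1 x hx (by nlinarith) (by nlinarith)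
      have h3 : d ≤ y := le_of_mul_le_mul_left (by linarith) hp
      have h4 : y ≤ d + ρ := le_of_mul_le_mul_left (by linarith) hp
      obtain ⟨e, he, z, hz, rfl⟩ := h.exists_preimage y hy
      have := h.nonneg z hz
      have := h.le_one z hz
      have hed : e = d := by
        rcases hd with rfl | rfl | rfl <;> rcases he with rfl | rfl | rfl <;>
          first | rfl | (exfalso; nlinarith)
      subst hed
      exact ⟨z, hz, by ring⟩
    · rw [pow_succ] at h1 ⊢
      rcases lt_or_ge (b + ρ ^ k) x with c | c
      · have := ih.2 x hx c
        nlinarith [mul_pos hp (sub_pos.2 hl1)]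
      · obtain ⟨y, hy, rfl⟩ := ih.1 x hx (by nlinarith) c
        have h3 : d + ρ < y := lt_of_mul_lt_mul_left (a := ρ ^ k) (by linarith) hp.le
        have h4 : d + ρ + ρ * (lam - ρ) ≤ y := by
          obtain ⟨e, he, z, hz, rfl⟩ := h.exists_preimage y hy
          have := h.nonneg z hz
          have := h.le_one z hz
          rcases hd with rfl | rfl | rfl <;> rcases he with rfl | rfl | rfl <;> nlinarith
        nlinarith

/-- A reflected copy of `E` inside `E` misses the rightmost level-`n` part of every cylinder,
for some `n`. -/
lemma exists_reflect_avoids (h : IsThreeMapAttractor ρ lam E) {r t : ℝ} (hr : 0 < r)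
    (hf : ∀ x ∈ E, t - r * x ∈ E) :
    ∃ n : ℕ, ∀ k b, IsOffset ρ lam k b → ∀ w ∈ E,
      ¬ (b + ρ ^ k * (1 - ρ ^ n) ≤ t - r * w ∧ t - r * w ≤ b + ρ ^ k) := by
  have hρ := h.rho_pos
  have hρ3 := h.rho_lt
  have hl1 := h.rho_lt_lam
  have hl2 := h.lam_lt
  obtain ⟨j, hj⟩ := exists_pow_lt_of_lt_one
    (show 0 < min r (ρ * (lam - ρ)) from lt_min hr (mul_pos hρ (by linarith)))
    (show ρ < 1 by linarith)
  refine ⟨j + 2, ?_⟩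
  rintro k b hb w₀ hw₀ ⟨hlow, hup⟩
  have hk : 0 < ρ ^ k := pow_pos hρ k
  have hk1 : ρ ^ k ≤ 1 := pow_le_one₀ hρ.le (by linarith)
  obtain ⟨w, ⟨hw, hwt⟩, hmin⟩ := (h.isCompact.inter_right
    (isClosed_Ici (a := (t - (b + ρ ^ k)) / r))).exists_isLeast
    ⟨w₀, hw₀, by rw [Set.mem_Ici, div_le_iff₀ hr]; linarith⟩
  rw [Set.mem_Ici, div_le_iff₀ hr] at hwt
  have hww₀ : w ≤ w₀ := hmin ⟨hw₀, by rw [Set.mem_Ici, div_le_iff₀ hr]; linarith⟩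
  have hgap : ∀ w' ∈ E, w' < w → ρ ^ k * (lam - ρ) ≤ r * (w - w') := by
    intro w' hw' hlt
    have h1 : b + ρ ^ k < t - r * w' := by
      by_contra! hcon
      have : w ≤ w' := hmin ⟨hw', by rw [Set.mem_Ici, div_le_iff₀ hr]; linarith⟩
      linarith
    have := (h.offset_separated hb).2 _ (hf w' hw') h1
    linarith
  obtain ⟨m, hm1, hm2⟩ : ∃ m : ℕ, r * ρ ^ m < ρ ^ k * (lam - ρ) ∧
      ρ ^ j * ρ ^ k ≤ r * ρ ^ m := by
    have hx : 0 < ρ ^ k * (lam - ρ) / r := div_pos (mul_pos hk (by linarith)) hr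
    have hjr := hj.trans_le (min_le_left _ _)
    have hjg := hj.trans_le (min_le_right _ _)
    rcases lt_or_ge (ρ ^ k * (lam - ρ)) r with c | c
    · obtain ⟨m, h1, h2⟩ := exists_nat_pow_near_of_lt_one hx ((div_le_one hr).2 c.le) hρ
        (by linarith)
      rw [lt_div_iff₀ hr] at h1
      rw [div_le_iff₀ hr] at h2
      refine ⟨m + 1, by linarith, ?_⟩
      rw [pow_succ]
      nlinarith [mul_lt_mul_of_pos_right hjg hk, mul_le_mul_of_nonneg_left h2 hρ.le]
    · rcases c.lt_or_eq with c | c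
      · exact ⟨0, by simpa using c, by simp; nlinarith [pow_pos hρ j]⟩
      · refine ⟨1, by rw [pow_one, ← c]; nlinarith, ?_⟩
        rw [pow_one, c]
        nlinarith
  obtain ⟨a, ha, v, hv, hwa⟩ := h.exists_offset m w hw
  have hpm : 0 < ρ ^ m := pow_pos hρ m
  have hv0 : v = 0 := by
    by_contra hne
    have hvpos : 0 < v := lt_of_le_of_ne (h.nonneg v hv) (Ne.symm hne)
    have haE : a ∈ E := by simpa using h.offset_mem ha 0 h.zero_mem
    have h1 := hgap a haE (by nlinarith)
    have h2 : w - a ≤ ρ ^ m := by nlinarith [h.le_one v hv]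
    nlinarith
  have hwa : w = a := by simpa [hv0] using hwa
  subst hwa
  have hzlow : b + ρ ^ k * (1 - ρ ^ (j + 2)) ≤ t - r * w := by nlinarith
  refine h.not_reflect_near_one (κ := r * ρ ^ m / ρ ^ k) (ε := 1 - (t - r * w - b) / ρ ^ k)
    (j := j) ((le_div_iff₀ hk).2 hm2) ?_ ?_ ?_
  · rw [sub_nonneg, div_le_one hk]
    linarith
  · rw [sub_le_comm, le_div_iff₀ hk]
    linarith
  · intro x hx
    have hx0 := h.nonneg x hx
    have hx1 := h.le_one x hx
    have h1 := hf _ (h.offset_mem ha x hx)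
    have h2 : r * ρ ^ m * x ≤ ρ ^ k * (lam - ρ) := by
      nlinarith [mul_pos hr hpm]
    have hj2 : ρ ^ (j + 2) ≤ 1 / 3 := by
      have : ρ ^ (j + 2) ≤ ρ ^ 1 := pow_le_pow_of_le_one hρ.le (by linarith) (by omega)
      linarith
    obtain ⟨y, hy, hxy⟩ := (h.offset_separated hb).1 _ h1
      (by nlinarith) (by nlinarith [mul_nonneg (mul_pos hr hpm).le hx0])
    convert hy using 1
    field_simp
    linarith

lemma packingLE_cylinder_succ (h : IsThreeMapAttractor ρ lam E) {G : Set ℝ} {k : ℕ} {b δ : ℝ}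
    {N₁ N₂ N₃ : ℕ}
    (h₁ : PackingLE (G ∩ (fun x => b + ρ ^ k * 0 + ρ ^ (k + 1) * x) '' E) δ N₁)
    (h₂ : PackingLE (G ∩ (fun x => b + ρ ^ k * lam + ρ ^ (k + 1) * x) '' E) δ N₂)
    (h₃ : PackingLE (G ∩ (fun x => b + ρ ^ k * (1 - ρ) + ρ ^ (k + 1) * x) '' E) δ N₃) :
    PackingLE (G ∩ (fun x => b + ρ ^ k * x) '' E) δ (N₁ + N₂ + N₃) := by
  refine ((h₁.union h₂).union h₃).mono ?_
  rintro _ ⟨hG, x, hx, rfl⟩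
  obtain ⟨d, hd, y, hy, rfl⟩ := h.exists_preimage x hx
  rcases hd with rfl | rfl | rfl
  · exact Or.inl (Or.inl ⟨hG, y, hy, by ring⟩)
  · exact Or.inl (Or.inr ⟨hG, y, hy, by ring⟩)
  · exact Or.inr ⟨hG, y, hy, by ring⟩

lemma packingLE_three_pow (h : IsThreeMapAttractor ρ lam E) {G : Set ℝ} {δ : ℝ} {M : ℕ} (i : ℕ) :
    ∀ k : ℕ, (∀ b, IsOffset ρ lam (k + i) b →
        PackingLE (G ∩ (fun x => b + ρ ^ (k + i) * x) '' E) δ M) →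
      ∀ b, IsOffset ρ lam k b → PackingLE (G ∩ (fun x => b + ρ ^ k * x) '' E) δ (3 ^ i * M) := by
  induction i with
  | zero => intro k hM b hb; simpa using hM b hb
  | succ i ih =>
    intro k hM b hb
    have h1 := ih (k + 1) (by simpa only [add_assoc, add_comm 1 i] using hM)
    have := h.packingLE_cylinder_succ (h1 _ (hb.step (.inl rfl)))
      (h1 _ (hb.step (.inr (.inl rfl)))) (h1 _ (hb.step (.inr (.inr rfl))))
    convert this using 1
    ring

/-- If `G` misses the rightmost level-`n` part of the cylinder at `b`, the packing bound for
level-`n` subcylinders gives a bound with `3 ^ i - 1` in place of `3 ^ i`. -/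
lemma packingLE_three_pow_sub_one (h : IsThreeMapAttractor ρ lam E) {G : Set ℝ} {δ : ℝ} {M : ℕ}
    (i : ℕ) : ∀ k b, IsOffset ρ lam k b →
      (∀ x ∈ G, ¬ (b + ρ ^ k * (1 - ρ ^ i) ≤ x ∧ x ≤ b + ρ ^ k)) →
      (∀ b, IsOffset ρ lam (k + i) b →
        PackingLE (G ∩ (fun x => b + ρ ^ (k + i) * x) '' E) δ M) →
      PackingLE (G ∩ (fun x => b + ρ ^ k * x) '' E) δ ((3 ^ i - 1) * M) := by
  have hρ := h.rho_pos
  induction i with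
  | zero =>
    intro k b hb hG _ S hS _
    have hk : 0 < ρ ^ k := pow_pos hρ k
    have : S = ∅ := by
      refine Finset.eq_empty_of_forall_notMem fun x hx => ?_
      obtain ⟨hxG, y, hy, rfl⟩ := hS hx
      exact hG _ hxG ⟨by simp; nlinarith [h.nonneg y hy], by nlinarith [h.le_one y hy]⟩
    simp [this]
  | succ i ih =>
    intro k b hb hG hM
    have hM' : ∀ b, IsOffset ρ lam (k + 1 + i) b →
        PackingLE (G ∩ (fun x => b + ρ ^ (k + 1 + i) * x) '' E) δ M := by
      simpa only [add_assoc, add_comm 1 i] using hM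
    have h1 := h.packingLE_three_pow i (k + 1) hM'
    have h2 := ih (k + 1) _ (hb.step (.inr (.inr rfl))) (fun x hx hcon => hG x hx
      ⟨le_trans (le_of_eq (by ring)) hcon.1, hcon.2.trans (le_of_eq (by ring))⟩) hM'
    have h3 := h.packingLE_cylinder_succ (h1 _ (hb.step (.inl rfl)))
      (h1 _ (hb.step (.inr (.inl rfl)))) h2
    convert h3 using 1
    have : 1 ≤ 3 ^ i := Nat.one_le_pow _ _ (by norm_num)
    obtain ⟨c, hc⟩ := Nat.exists_eq_add_of_le this
    rw [pow_succ, hc]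
    have e1 : (1 + c) * 3 - 1 = 3 * c + 2 := by omega
    have e2 : 1 + c - 1 = c := by omega
    rw [e1, e2]
    ring

lemma packingLE_of_avoids (h : IsThreeMapAttractor ρ lam E) {G : Set ℝ} {n : ℕ}
    (hG : ∀ k b, IsOffset ρ lam k b → ∀ x ∈ G,
      ¬ (b + ρ ^ k * (1 - ρ ^ n) ≤ x ∧ x ≤ b + ρ ^ k)) (q : ℕ) :
    ∀ k b, IsOffset ρ lam k b →
      PackingLE (G ∩ (fun x => b + ρ ^ k * x) '' E) (ρ ^ (k + n * q)) ((3 ^ n - 1) ^ q) := by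
  have hρ := h.rho_pos
  induction q with
  | zero =>
    intro k b _
    have hk : 0 < ρ ^ k := pow_pos hρ k
    rw [pow_zero]
    refine PackingLE.of_subset_Icc (a := b) ?_
    rintro _ ⟨-, y, hy, rfl⟩
    exact ⟨by nlinarith [h.nonneg y hy], by simp; nlinarith [h.le_one y hy]⟩
  | succ q ih =>
    intro k b hb
    rw [pow_succ' (3 ^ n - 1)]
    refine h.packingLE_three_pow_sub_one n k b hb (hG k b hb) fun b' hb' => ?_
    have := ih (k + n) b' hb'
    convert this using 2
    ring

lemma exists_separated_finset (h : IsThreeMapAttractor ρ lam E) (m : ℕ) :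
    ∃ T : Finset ℝ, (T : Set ℝ) ⊆ E ∧ T.card = 3 ^ m ∧
      ∀ x ∈ T, ∀ y ∈ T, x ≠ y → ρ ^ m * (lam - ρ) < |x - y| := by
  classical
  have hρ := h.rho_pos
  have hρ3 := h.rho_lt
  have hl1 := h.rho_lt_lam
  have hl2 := h.lam_lt
  induction m with
  | zero =>
    refine ⟨{0}, by simpa using h.zero_mem, by simp, ?_⟩
    intro x hx y hy hne
    simp only [Finset.mem_singleton] at hx hy
    exact absurd (hx.trans hy.symm) hne
  | succ m ih =>
    obtain ⟨T, hTE, hcard, hsep⟩ := ih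
    have hm1 : ρ ^ (m + 1) < 1 := pow_lt_one₀ hρ.le (by linarith) (by omega)
    have hfar : ∀ c d, (c = 0 ∨ c = lam ∨ c = 1 - ρ) → (d = 0 ∨ d = lam ∨ d = 1 - ρ) → c ≠ d →
        ∀ x ∈ T, ∀ y ∈ T, ρ ^ (m + 1) * (lam - ρ) < |(c + ρ * x) - (d + ρ * y)| := by
      intro c d hc hd hne x hx y hy
      have hx0 := h.nonneg x (hTE hx)
      have hx1 := h.le_one x (hTE hx)
      have hy0 := h.nonneg y (hTE hy)
      have hy1 := h.le_one y (hTE hy)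
      have h1 : ρ ^ (m + 1) * (lam - ρ) < lam - ρ := by nlinarith
      refine h1.trans_le ?_
      rw [le_abs]
      rcases hc with rfl | rfl | rfl <;> rcases hd with rfl | rfl | rfl <;>
        first
        | exact absurd rfl hne
        | (left; nlinarith)
        | (right; nlinarith)
    have hinj : ∀ d : ℝ, Function.Injective fun x => d + ρ * x := fun d x y hxy => by
      simpa [hρ.ne'] using hxy
    have hpos : 0 < ρ ^ (m + 1) * (lam - ρ) := mul_pos (pow_pos hρ _) (by linarith)
    have hdisj : ∀ c d, (c = 0 ∨ c = lam ∨ c = 1 - ρ) → (d = 0 ∨ d = lam ∨ d = 1 - ρ) → c ≠ d →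
        Disjoint (T.image fun x => c + ρ * x) (T.image fun x => d + ρ * x) := by
      intro c d hc hd hne
      rw [Finset.disjoint_left]
      intro z hz1 hz2
      obtain ⟨x, hx, rfl⟩ := Finset.mem_image.1 hz1
      obtain ⟨y, hy, hxy⟩ := Finset.mem_image.1 hz2
      have := hfar c d hc hd hne x hx y hy
      simp only [hxy, sub_self, abs_zero] at this
      linarith
    have hmem : ∀ z, z ∈ (T.image fun x => 0 + ρ * x) ∪ (T.image fun x => lam + ρ * x) ∪
        (T.image fun x => 1 - ρ + ρ * x) →
        ∃ d, (d = 0 ∨ d = lam ∨ d = 1 - ρ) ∧ ∃ x ∈ T, z = d + ρ * x := by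
      intro z hz
      simp only [Finset.mem_union, Finset.mem_image] at hz
      rcases hz with (⟨x, hx, rfl⟩ | ⟨x, hx, rfl⟩) | ⟨x, hx, rfl⟩
      · exact ⟨0, by simp, x, hx, rfl⟩
      · exact ⟨lam, by simp, x, hx, rfl⟩
      · exact ⟨1 - ρ, by simp, x, hx, rfl⟩
    refine ⟨(T.image fun x => 0 + ρ * x) ∪ (T.image fun x => lam + ρ * x) ∪
        (T.image fun x => 1 - ρ + ρ * x), ?_, ?_, ?_⟩
    · intro z hz
      obtain ⟨d, hd, x, hx, rfl⟩ := hmem z hz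
      exact h.image_mem d hd x (hTE hx)
    · rw [Finset.card_union_of_disjoint, Finset.card_union_of_disjoint,
        Finset.card_image_of_injective _ (hinj _), Finset.card_image_of_injective _ (hinj _),
        Finset.card_image_of_injective _ (hinj _), hcard]
      · ring
      · exact hdisj _ _ (by simp) (by simp) (by linarith)
      · rw [Finset.disjoint_union_left]
        exact ⟨hdisj _ _ (by simp) (by simp) (by linarith),
          hdisj _ _ (by simp) (by simp) (by linarith)⟩
    · intro z hz z' hz' hne
      obtain ⟨c, hc, x, hx, rfl⟩ := hmem z hz
      obtain ⟨d, hd, y, hy, rfl⟩ := hmem z' hz'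
      by_cases hcd : c = d
      · subst hcd
        have hxy : x ≠ y := by
          rintro rfl
          exact hne rfl
        have := hsep x hx y hy hxy
        rw [add_sub_add_left_eq_sub, ← mul_sub, abs_mul, abs_of_pos hρ, pow_succ', mul_assoc]
        exact mul_lt_mul_of_pos_left this hρ
      · exact hfar c d hc hd hcd x hx y hy

/-- No reflected copy of `E` is contained in `E`. -/
theorem not_reflect_subset (h : IsThreeMapAttractor ρ lam E) {r t : ℝ} (hr : 0 < r) :
    ¬ ∀ x ∈ E, t - r * x ∈ E := by
  classical
  intro hf
  have hρ := h.rho_pos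
  have hρ3 := h.rho_lt
  have hl1 := h.rho_lt_lam
  obtain ⟨n, hn⟩ := h.exists_reflect_avoids hr hf
  obtain ⟨n₀, hn₀⟩ := exists_pow_lt_of_lt_one
    (show 0 < r * (lam - ρ) from mul_pos hr (by linarith)) (show ρ < 1 by linarith)
  have h3n : 1 ≤ 3 ^ n := Nat.one_le_pow _ _ (by norm_num)
  have hpack := fun q => h.packingLE_of_avoids (G := (fun x => t - r * x) '' E) (n := n)
    (by
      rintro k b hb _ ⟨w, hw, rfl⟩
      exact hn k b hb w hw) q 0 0 .zero
  have hcount : ∀ q, n₀ ≤ n * q → 3 ^ (n * q - n₀) ≤ (3 ^ n - 1) ^ q := by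
    intro q hq
    obtain ⟨T, hTE, hcard, hsep⟩ := h.exists_separated_finset (n * q - n₀)
    have hinj : Function.Injective fun x => t - r * x := fun x y hxy => by
      simpa [hr.ne'] using hxy
    have := hpack q (T.image fun x => t - r * x) ?_ ?_
    · rwa [Finset.card_image_of_injective _ hinj, hcard] at this
    · intro z hz
      obtain ⟨x, hx, rfl⟩ := Finset.mem_image.1 (Finset.mem_coe.1 hz)
      exact ⟨⟨x, hTE hx, rfl⟩, t - r * x, hf x (hTE hx), by simp⟩
    · intro z hz z' hz' hne
      obtain ⟨x, hx, rfl⟩ := Finset.mem_image.1 hz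
      obtain ⟨y, hy, rfl⟩ := Finset.mem_image.1 hz'
      have hxy : x ≠ y := by
        rintro rfl
        exact hne rfl
      have h1 := hsep x hx y hy hxy
      have h2 : t - r * x - (t - r * y) = -(r * (x - y)) := by ring
      rw [h2, abs_neg, abs_mul, abs_of_pos hr, zero_add]
      have h3 : ρ ^ (n * q) = ρ ^ (n * q - n₀) * ρ ^ n₀ := by
        rw [← pow_add, Nat.sub_add_cancel hq]
      have h4 := pow_pos hρ (n * q - n₀)
      rw [h3]
      nlinarith
  have h3r : (1 : ℝ) ≤ 3 ^ n := by exact_mod_cast h3n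
  have hlt : ((3 : ℝ) ^ n - 1) / 3 ^ n < 1 := (div_lt_one (by positivity)).2 (by linarith)
  obtain ⟨q, hq⟩ := exists_pow_lt_of_lt_one (show (0 : ℝ) < (1 / 3) ^ n₀ by positivity) hlt
  have hn1 : n ≠ 0 := by
    rintro rfl
    exact hn 0 0 .zero 0 h.zero_mem
      ⟨by simpa using h.nonneg _ (hf 0 h.zero_mem), by simpa using h.le_one _ (hf 0 h.zero_mem)⟩
  have hq' : ((3 : ℝ) ^ n - 1) ^ q * 3 ^ n₀ < 3 ^ (n * q) := by
    rw [div_pow, div_lt_iff₀ (by positivity), div_pow, one_pow, div_mul_eq_mul_div, one_mul,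
      lt_div_iff₀ (by positivity), ← pow_mul] at hq
    exact hq
  have hqN : (3 ^ n - 1) ^ q * 3 ^ n₀ < 3 ^ (n * q) := by
    have : (((3 ^ n - 1 : ℕ) : ℝ)) = 3 ^ n - 1 := by
      rw [Nat.cast_sub h3n]
      simp
    rw [← this] at hq'
    exact_mod_cast hq'
  have hpos : 0 < 3 ^ n - 1 := Nat.sub_pos_of_lt (Nat.one_lt_pow hn1 (by norm_num))
  have hle : n₀ ≤ n * q := by
    have h1 : 3 ^ n₀ ≤ (3 ^ n - 1) ^ q * 3 ^ n₀ := Nat.le_mul_of_pos_left _ (pow_pos hpos q)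
    exact ((Nat.pow_lt_pow_iff_right (by norm_num)).1 (h1.trans_lt hqN)).le
  have h1 := Nat.mul_le_mul_right (3 ^ n₀) (hcount q hle)
  rw [← pow_add, Nat.sub_add_cancel hle] at h1
  omega

end IsThreeMapAttractor

theorem no_negative_ratio (ρ lam : ℝ) (E : Set ℝ)
    (hρ0 : 0 < ρ) (hρ3 : ρ < 1 / 3) (hl1 : ρ < lam) (hl2 : lam < (1 - ρ) / 2)
    (hEc : IsCompact E) (hEne : E.Nonempty)
    (hE : E = (fun x : ℝ => ρ * x) '' E ∪ (fun x : ℝ => ρ * x + lam) '' E ∪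
        (fun x : ℝ => ρ * x + (1 - ρ)) '' E) :
    ∀ r t : ℝ, 0 < r → r < 1 →
      ¬ (fun x : ℝ => -r * x + t) ''
          ((fun x : ℝ => ρ * x) '' E ∪ (fun x : ℝ => ρ * x + lam) '' E) ⊆ E := by
  intro r t hr _ hsub
  refine (IsThreeMapAttractor.of_eq_union hρ0 hρ3 hl1 hl2 hEc hEne hE).not_reflect_subset
    (t := t) (mul_pos hr hρ0) fun x hx => hsub ⟨ρ * x, Or.inl ⟨x, hx, rfl⟩, ?_⟩
  ring
end

section
/- Let 0 < ρ < 1/3 and let E be the attractor of {φ₁(x)=ρx, φ₂(x)=ρx+ρ, φ₃(x)=ρx+1−ρ} (the case λ = ρ). Then for every 0 < r < 1, the set −rE + ρ/(1−ρ) is not contained in φ₁(E) ∪ φ₂(E). -/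
/-- The functional equation of the attractor, in terms of membership. -/
def IsAttractor (ρ : ℝ) (E : Set ℝ) : Prop :=
  ∀ x, x ∈ E ↔ ∃ e ∈ E, x = ρ * e ∨ x = ρ * e + ρ ∨ x = ρ * e + (1 - ρ)

namespace IsAttractor

variable {ρ : ℝ} {E : Set ℝ}

lemma left_mem (h : IsAttractor ρ E) {e : ℝ} (he : e ∈ E) : ρ * e ∈ E :=
  (h _).2 ⟨e, he, Or.inl rfl⟩

lemma middle_mem (h : IsAttractor ρ E) {e : ℝ} (he : e ∈ E) : ρ * e + ρ ∈ E :=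
  (h _).2 ⟨e, he, Or.inr (Or.inl rfl)⟩

lemma right_mem (h : IsAttractor ρ E) {e : ℝ} (he : e ∈ E) : ρ * e + (1 - ρ) ∈ E :=
  (h _).2 ⟨e, he, Or.inr (Or.inr rfl)⟩

lemma isLeast_zero (h : IsAttractor ρ E) (hρ0 : 0 < ρ) (hρ3 : ρ < 1 / 3)
    (hEc : IsCompact E) (hEne : E.Nonempty) : IsLeast E 0 := by
  obtain ⟨m, hm, hmin⟩ := hEc.exists_isLeast hEne
  have h1 : m ≤ ρ * m := hmin (h.left_mem hm)
  have h2 : 0 ≤ m := by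
    obtain ⟨e, he, h3⟩ := (h m).1 hm
    have h4 := mul_le_mul_of_nonneg_left (hmin he) hρ0.le
    rcases h3 with h3 | h3 | h3 <;> nlinarith
  have h3 : m = 0 := by nlinarith
  exact h3 ▸ ⟨hm, hmin⟩

lemma isGreatest_one (h : IsAttractor ρ E) (hρ0 : 0 < ρ) (hρ3 : ρ < 1 / 3)
    (hEc : IsCompact E) (hEne : E.Nonempty) : IsGreatest E 1 := by
  obtain ⟨m, hm, hmax⟩ := hEc.exists_isGreatest hEne
  have h1 : ρ * m + (1 - ρ) ≤ m := hmax (h.right_mem hm)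
  have h2 : m ≤ 1 := by
    obtain ⟨e, he, h3⟩ := (h m).1 hm
    have h4 := mul_le_mul_of_nonneg_left (hmax he) hρ0.le
    rcases h3 with h3 | h3 | h3 <;> nlinarith
  have h3 : m = 1 := by nlinarith
  exact h3 ▸ ⟨hm, hmax⟩

/-- The first-level gap of the attractor. -/
lemma notMem_gap (h : IsAttractor ρ E) (hρ0 : 0 < ρ) (hE : E ⊆ Set.Icc 0 1) :
    ∀ x ∈ E, x ∉ Set.Ioo (2 * ρ) (1 - ρ) := by
  rintro x hx ⟨h1, h2⟩
  obtain ⟨e, he, h3⟩ := (h x).1 hx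
  have h4 := mul_nonneg hρ0.le (hE he).1
  have h5 := mul_le_mul_of_nonneg_left (hE he).2 hρ0.le
  rcases h3 with h3 | h3 | h3 <;> linarith

lemma notMem_left_gap (h : IsAttractor ρ E) (hρ0 : 0 < ρ) (hρ3 : ρ < 1 / 3) (hE : E ⊆ Set.Icc 0 1)
    {a b : ℝ} (hb : b ≤ 1) (hab : ∀ x ∈ E, x ∉ Set.Ioo a b) :
    ∀ x ∈ E, x ∉ Set.Ioo (ρ * a) (ρ * b) := by
  rintro x hx ⟨h1, h2⟩
  obtain ⟨e, he, h3⟩ := (h x).1 hx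
  have h4 := mul_nonneg hρ0.le (hE he).1
  have h5 := mul_le_mul_of_nonneg_left hb hρ0.le
  rcases h3 with rfl | h3 | h3
  · exact hab e he ⟨lt_of_mul_lt_mul_left h1 hρ0.le, lt_of_mul_lt_mul_left h2 hρ0.le⟩
  all_goals linarith

lemma notMem_middle_gap (h : IsAttractor ρ E) (hρ0 : 0 < ρ) (hρ3 : ρ < 1 / 3)
    (hE : E ⊆ Set.Icc 0 1) {a b : ℝ} (ha : 0 ≤ a) (hb : b ≤ 1) (hab : ∀ x ∈ E, x ∉ Set.Ioo a b) :
    ∀ x ∈ E, x ∉ Set.Ioo (ρ * a + ρ) (ρ * b + ρ) := by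
  rintro x hx ⟨h1, h2⟩
  obtain ⟨e, he, h3⟩ := (h x).1 hx
  have h4 := mul_nonneg hρ0.le (hE he).1
  have h5 := mul_le_mul_of_nonneg_left hb hρ0.le
  have h6 := mul_le_mul_of_nonneg_left (hE he).2 hρ0.le
  have h7 := mul_nonneg hρ0.le ha
  rcases h3 with h3 | rfl | h3
  · linarith
  · exact hab e he ⟨lt_of_mul_lt_mul_left (by linarith) hρ0.le,
      lt_of_mul_lt_mul_left (by linarith) hρ0.le⟩
  · linarith

/-- Gaps are carried to gaps by the iterates of `x ↦ ρ * x + ρ`, whose fixed point is `c`. -/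
lemma notMem_iterate_middle_gap (h : IsAttractor ρ E) (hρ0 : 0 < ρ) (hρ3 : ρ < 1 / 3)
    (hE : E ⊆ Set.Icc 0 1) {c : ℝ} (hc0 : 0 ≤ c) (hc1 : c ≤ 1) (hc : ρ * c + ρ = c) {a b : ℝ}
    (ha : 0 ≤ a) (hb : b ≤ 1) (hab : ∀ x ∈ E, x ∉ Set.Ioo a b) (n : ℕ) :
    ∀ x ∈ E, x ∉ Set.Ioo (c + ρ ^ n * (a - c)) (c + ρ ^ n * (b - c)) := by
  induction n with
  | zero => simpa using hab
  | succ n ih =>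
    have hp : 0 ≤ ρ ^ n := by positivity
    have hp1 : ρ ^ n ≤ 1 := pow_le_one₀ hρ0.le (by linarith)
    have key := h.notMem_middle_gap hρ0 hρ3 hE (a := c + ρ ^ n * (a - c))
      (b := c + ρ ^ n * (b - c)) (by nlinarith) (by nlinarith) ih
    have shift : ∀ y, c + ρ ^ (n + 1) * (y - c) = ρ * (c + ρ ^ n * (y - c)) + ρ := fun y => by
      linear_combination -hc
    rwa [shift, shift]

/-- An open subinterval of `[0, 1]` longer than the first-level gap meets the attractor. -/
lemma exists_mem_Ioo (h : IsAttractor ρ E) (hρ0 : 0 < ρ) (hρ3 : ρ < 1 / 3)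
    (h0 : (0 : ℝ) ∈ E) (h1 : (1 : ℝ) ∈ E) {a b : ℝ} (ha : 0 ≤ a) (hb : b ≤ 1)
    (hab : 1 - 3 * ρ < b - a) : ∃ e ∈ E, e ∈ Set.Ioo a b := by
  obtain ⟨n, hn⟩ := exists_pow_lt_of_lt_one (show (0 : ℝ) < 1 - 3 * ρ by linarith)
    (show ρ < 1 by linarith)
  replace hn := hn.trans hab
  induction n generalizing a b with
  | zero => exact absurd hn (by simp; linarith)
  | succ n ih =>
    have hscale : ∀ q, q ≤ a → b ≤ q + ρ → ∃ e ∈ E, ρ * e + q ∈ Set.Ioo a b := by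
      intro q hqa hqb
      have hd : (b - a) / ρ = (b - q) / ρ - (a - q) / ρ := by ring
      obtain ⟨e, he, he1, he2⟩ := ih (a := (a - q) / ρ) (b := (b - q) / ρ)
        (div_nonneg (by linarith) hρ0.le) (by rw [div_le_one hρ0]; linarith)
        (by rw [← hd, lt_div_iff₀ hρ0]; nlinarith)
        (by rw [← hd, lt_div_iff₀ hρ0, ← pow_succ]; exact hn)
      rw [div_lt_iff₀ hρ0] at he1
      rw [lt_div_iff₀ hρ0] at he2
      exact ⟨e, he, by linarith, by linarith⟩
    have m1 : ρ ∈ E := by simpa using h.left_mem h1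
    have m2 : 2 * ρ ∈ E := by simpa [two_mul] using h.middle_mem h1
    have m3 : 1 - ρ ∈ E := by simpa using h.right_mem h0
    by_contra! hcon
    have n1 := hcon _ m1
    have n2 := hcon _ m2
    have n3 := hcon _ m3
    simp only [Set.mem_Ioo, not_and, not_lt] at n1 n2 n3
    rcases lt_or_ge a ρ with a1 | a1
    · obtain ⟨e, he, hm⟩ := hscale 0 ha (by linarith [n1 a1])
      exact hcon _ (h.left_mem he) (by simpa using hm)
    rcases lt_or_ge a (2 * ρ) with a2 | a2
    · obtain ⟨e, he, hm⟩ := hscale ρ a1 (by linarith [n2 a2])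
      exact hcon _ (h.middle_mem he) hm
    rcases lt_or_ge a (1 - ρ) with a3 | a3
    · linarith [n3 a3]
    · obtain ⟨e, he, hm⟩ := hscale (1 - ρ) a3 (by linarith)
      exact hcon _ (h.right_mem he) hm

lemma exists_affine_mem_Ioo (h : IsAttractor ρ E) (hρ0 : 0 < ρ) (hρ3 : ρ < 1 / 3)
    (h0 : (0 : ℝ) ∈ E) (h1 : (1 : ℝ) ∈ E) {p t l u : ℝ} (ht : 0 < t) (hl : p ≤ l)
    (hu : u ≤ p + t) (hlu : (1 - 3 * ρ) * t < u - l) : ∃ e ∈ E, p + t * e ∈ Set.Ioo l u := by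
  obtain ⟨e, he, he1, he2⟩ := h.exists_mem_Ioo hρ0 hρ3 h0 h1 (a := (l - p) / t)
    (b := (u - p) / t) (div_nonneg (by linarith) ht.le) (by rw [div_le_one ht]; linarith)
    (by rw [← sub_div, lt_div_iff₀ ht]; linarith)
  rw [div_lt_iff₀ ht] at he1
  rw [lt_div_iff₀ ht] at he2
  exact ⟨e, he, by linarith, by linarith⟩

/-- No scaled copy `M - s * E` avoids both the first-level gap and the gap of the middle piece. -/
lemma exists_sub_mul_mem_gap (h : IsAttractor ρ E) (hρ0 : 0 < ρ) (hρ3 : ρ < 1 / 3)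
    (h0 : (0 : ℝ) ∈ E) (h1 : (1 : ℝ) ∈ E) {M s : ℝ} (hM : M * (1 - ρ) = 1)
    (hs1 : ρ * (M + 1) < s) (hs2 : s ≤ M + 1) :
    ∃ x ∈ E, M - s * x ∈ Set.Ioo (2 * ρ) (1 - ρ) ∪
      Set.Ioo (ρ * (2 * ρ) + ρ) (ρ * (1 - ρ) + ρ) := by
  by_contra! hcon
  have gap : ∀ x ∈ E, s * x ∉ Set.Ioo (ρ * (M + 1)) (M - 2 * ρ) := fun x hx hm =>
    hcon x hx (Or.inl ⟨by linarith [hm.2], by linarith [hm.1]⟩)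
  have gap' : ∀ x ∈ E, s * x ∉ Set.Ioo (M - 2 * ρ + ρ ^ 2) (M - ρ - 2 * ρ ^ 2) := fun x hx hm =>
    hcon x hx (Or.inr ⟨by linarith [hm.2], by linarith [hm.1]⟩)
  have hM1 : 1 < M := by nlinarith
  have hM2 : M < 3 / 2 := by nlinarith
  have hs0 : 0 < s := lt_trans (by positivity) hs1
  have ht0 : 0 < s * ρ := by positivity
  have ht1 : s * ρ < 1 := by nlinarith
  have hg : (1 - 3 * ρ) * (s * ρ) < (M - 2 * ρ) - ρ * (M + 1) := by nlinarith
  have hsr : M - 2 * ρ ≤ s := by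
    by_contra! hlt
    exact gap 1 h1 ⟨by linarith, by linarith⟩
  have h2ρ : s * (2 * ρ) ≤ ρ * (M + 1) := by
    by_contra! hlt
    have hge : M - 2 * ρ ≤ s * (2 * ρ) := by
      by_contra! hlt'
      exact gap (2 * ρ) (by simpa [two_mul] using h.middle_mem h1) ⟨hlt, hlt'⟩
    obtain ⟨e, he, hm⟩ := h.exists_affine_mem_Ioo hρ0 hρ3 h0 h1 (p := s * ρ) ht0
      (by nlinarith) (by linarith) hg
    exact gap _ (h.middle_mem he) (by convert hm using 1; ring)
  have h1ρ : M - 2 * ρ ≤ s * (1 - ρ) := by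
    by_contra! hlt
    have hle : s * (1 - ρ) ≤ ρ * (M + 1) := by
      by_contra! hlt'
      exact gap (1 - ρ) (by simpa using h.right_mem h0) ⟨hlt', hlt⟩
    obtain ⟨e, he, hm⟩ := h.exists_affine_mem_Ioo hρ0 hρ3 h0 h1 (p := s * (1 - ρ)) ht0
      hle (by linarith) hg
    exact gap _ (h.right_mem he) (by convert hm using 1; ring)
  have hs3 : s ≤ (M + 1) / 2 := by nlinarith
  have hs4 : 1 < s := by
    have e1 : (M - 2 * ρ) * M ≤ s := by nlinarith
    have e2 : M = 1 + ρ * M := by linarith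
    have e3 : (M - 2 * ρ) * M = 1 + (ρ * M) ^ 2 := by
      linear_combination (M + (1 + ρ * M)) * e2
    nlinarith [sq_pos_of_pos (show 0 < ρ * M by positivity)]
  have hlow : s * (1 - ρ) ≤ M - 2 * ρ + ρ ^ 2 := by
    by_contra! hlt
    refine gap' (1 - ρ) (by simpa using h.right_mem h0) ⟨hlt, ?_⟩
    have : s * (1 - ρ) ≤ (M + 1) / 2 * (1 - ρ) := by nlinarith
    have : M = 1 + ρ * M := by linarith
    nlinarith
  have hmem : ∀ e ∈ E, ρ * (ρ * e) + (1 - ρ) ∈ E := fun e he => h.right_mem (h.left_mem he)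
  have hup : M - ρ - 2 * ρ ^ 2 ≤ s * (1 - ρ) + s * ρ ^ 2 := by
    by_contra! hlt
    have hsq : 1 * ρ ^ 2 < s * ρ ^ 2 := mul_lt_mul_of_pos_right hs4 (by positivity)
    exact gap' _ (hmem 1 h1) ⟨by linarith, by linarith⟩
  obtain ⟨e, he, hm⟩ := h.exists_affine_mem_Ioo hρ0 hρ3 h0 h1 (p := s * (1 - ρ))
    (t := s * ρ ^ 2) (by positivity) hlow hup (by
      have : (1 - 3 * ρ) * ρ * (s * ρ) < (1 - 3 * ρ) * ρ * 1 :=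
        mul_lt_mul_of_pos_left ht1 (mul_pos (by linarith) hρ0)
      linarith)
  exact gap' _ (hmem e he) (by convert hm using 1; ring)

end IsAttractor

theorem no_negative_fixed_translation (ρ : ℝ) (E : Set ℝ)
    (hρ0 : 0 < ρ) (hρ3 : ρ < 1 / 3)
    (hEc : IsCompact E) (hEne : E.Nonempty)
    (hE : E = (fun x : ℝ => ρ * x) '' E ∪ (fun x : ℝ => ρ * x + ρ) '' E ∪
        (fun x : ℝ => ρ * x + (1 - ρ)) '' E) :
    ∀ r : ℝ, 0 < r → r < 1 →
      ¬ (fun x : ℝ => -r * x + ρ / (1 - ρ)) '' E ⊆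
          (fun x : ℝ => ρ * x) '' E ∪ (fun x : ℝ => ρ * x + ρ) '' E := by
  intro r hr0 hr1 hsub
  have h : IsAttractor ρ E := by
    intro x
    constructor
    · intro hx
      rw [hE] at hx
      rcases hx with (⟨e, he, rfl⟩ | ⟨e, he, rfl⟩) | ⟨e, he, rfl⟩
      exacts [⟨e, he, Or.inl rfl⟩, ⟨e, he, Or.inr (Or.inl rfl)⟩, ⟨e, he, Or.inr (Or.inr rfl)⟩]
    · rintro ⟨e, he, rfl | rfl | rfl⟩ <;> rw [hE]
      exacts [Or.inl (Or.inl ⟨e, he, rfl⟩), Or.inl (Or.inr ⟨e, he, rfl⟩), Or.inr ⟨e, he, rfl⟩]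
  have hleast := h.isLeast_zero hρ0 hρ3 hEc hEne
  have hgreatest := h.isGreatest_one hρ0 hρ3 hEc hEne
  have hI : E ⊆ Set.Icc 0 1 := fun x hx => ⟨hleast.2 hx, hgreatest.2 hx⟩
  have hrefl : ∀ x ∈ E, ρ / (1 - ρ) - r * x ∈ E := by
    intro x hx
    have hx' : -r * x + ρ / (1 - ρ) ∈ E := by
      rw [hE]
      exact Or.inl (hsub ⟨x, hx, rfl⟩)
    convert hx' using 1
    ring
  obtain ⟨M, hMdef⟩ : ∃ M : ℝ, M = 1 / (1 - ρ) := ⟨_, rfl⟩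
  have hM : M * (1 - ρ) = 1 := by
    rw [hMdef]
    exact div_mul_cancel₀ _ (by linarith)
  have hc : ρ / (1 - ρ) = ρ * M := by
    rw [hMdef]
    ring
  rw [hc] at hrefl
  have hM1 : 1 < M := by nlinarith
  have hM2 : M < 3 / 2 := by nlinarith
  obtain ⟨n, hn1, hn2⟩ := exists_nat_pow_near_of_lt_one (x := r / (M + 1)) (y := ρ)
    (by positivity) (by rw [div_le_one (by linarith)]; linarith) hρ0 (by linarith)
  rw [lt_div_iff₀ (by linarith)] at hn1
  rw [div_le_iff₀ (by linarith)] at hn2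
  have hp : 0 < ρ ^ n := by positivity
  obtain ⟨s, rfl⟩ : ∃ s, r = ρ ^ n * s := ⟨r / ρ ^ n, by field_simp⟩
  obtain ⟨x, hx, hmem⟩ := h.exists_sub_mul_mem_gap hρ0 hρ3 hleast.1 hgreatest.1 hM (s := s)
    (lt_of_mul_lt_mul_left (by rw [pow_succ] at hn1; linarith) hp.le)
    (le_of_mul_le_mul_left hn2 hp)
  have avoid : ∀ a b : ℝ, 0 ≤ a → b ≤ 1 → (∀ y ∈ E, y ∉ Set.Ioo a b) →
      M - s * x ∉ Set.Ioo a b := by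
    rintro a b ha hb hab ⟨hl, hu⟩
    refine h.notMem_iterate_middle_gap hρ0 hρ3 hI (c := ρ * M) (by positivity) (by nlinarith)
      (by linear_combination -ρ * hM) (mul_nonneg hρ0.le ha) (by nlinarith)
      (h.notMem_left_gap hρ0 hρ3 hI hb hab) n _ (hrefl _ (h.left_mem hx)) ⟨?_, ?_⟩
    · have := mul_lt_mul_of_pos_left hl (mul_pos hp hρ0)
      linarith
    · have := mul_lt_mul_of_pos_left hu (mul_pos hp hρ0)
      linarith
  have hgap := h.notMem_gap hρ0 hI
  rcases hmem with hmem | hmem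
  · exact avoid _ _ (by linarith) (by linarith) hgap hmem
  · exact avoid _ _ (by nlinarith) (by nlinarith)
      (h.notMem_middle_gap hρ0 hρ3 hI (by linarith) (by linarith) hgap) hmem
end

section
/- Let 0 < ρ < 1/3, ρ ≤ λ ≤ 1−2ρ, and let E be the attractor of {φ₁(x)=ρx, φ₂(x)=ρx+λ, φ₃(x)=ρx+1−ρ}. Suppose f(x) = rx + t with 0 < |r| < 1 satisfies f(E) ⊆ E. If λ ≠ (1−ρ)/2, then f = φ_{i₁}∘⋯∘φ_{i_n} for some finite word i₁…i_n over {1,2,3}; if λ = (1−ρ)/2, then f = φ_{i₁}∘⋯∘φ_{i_n} or f(x) = φ_{i₁}∘⋯∘φ_{i_n}(1−x) for some such word. -/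
/-- Composition `φ_{i₁} ∘ φ_{i₂} ∘ ⋯ ∘ φ_{i_n}` along a finite word. -/
def compWord {ι : Type*} (φ : ι → ℝ → ℝ) (w : List ι) : ℝ → ℝ :=
  w.foldr (fun i g => φ i ∘ g) id

namespace ThreePiece

/-- The translation part of the `i`-th map of the system. -/
def shift (ρ lam : ℝ) : Fin 3 → ℝ := ![0, lam, 1 - ρ]

/-- The three similarities `x ↦ ρ x + shift i`. -/
def piece (ρ lam : ℝ) (i : Fin 3) (x : ℝ) : ℝ := ρ * x + shift ρ lam i

@[simp] lemma shift_zero (ρ lam : ℝ) : shift ρ lam 0 = 0 := rfl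
@[simp] lemma shift_one (ρ lam : ℝ) : shift ρ lam 1 = lam := rfl
@[simp] lemma shift_two (ρ lam : ℝ) : shift ρ lam 2 = 1 - ρ := rfl

/-- The properties of the attractor that are used: it spans `[0,1]` and is invariant. -/
structure IsAttractor (ρ lam : ℝ) (E : Set ℝ) : Prop where
  pos : 0 < ρ
  lt_third : ρ < 1 / 3
  le_lam : ρ ≤ lam
  lam_le : lam ≤ 1 - 2 * ρ
  nonneg : ∀ x ∈ E, 0 ≤ x
  le_one : ∀ x ∈ E, x ≤ 1
  zero_mem : (0 : ℝ) ∈ E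
  one_mem : (1 : ℝ) ∈ E
  piece_mem : ∀ i, ∀ x ∈ E, piece ρ lam i x ∈ E
  exists_piece : ∀ x ∈ E, ∃ i, ∃ y ∈ E, x = piece ρ lam i y

/-- The affine map `x ↦ r x + t` sends `E` into itself. -/
def Maps (E : Set ℝ) (r t : ℝ) : Prop := ∀ x ∈ E, r * x + t ∈ E

/-- The affine map `x ↦ r x + t` is a composition of the three similarities. -/
def IsWord (ρ lam r t : ℝ) : Prop :=
  ∃ w : List (Fin 3), ∀ x : ℝ, r * x + t = compWord (piece ρ lam) w x

lemma compWord_cons {ι : Type*} (φ : ι → ℝ → ℝ) (i : ι) (w : List ι) (x : ℝ) :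
    compWord φ (i :: w) x = φ i (compWord φ w x) := rfl

lemma compWord_append {ι : Type*} (φ : ι → ℝ → ℝ) (v w : List ι) (x : ℝ) :
    compWord φ (v ++ w) x = compWord φ v (compWord φ w x) := by
  induction v with
  | nil => rfl
  | cons i v ih => rw [List.cons_append, compWord_cons, compWord_cons, ih]

lemma compWord_piece (ρ lam : ℝ) (w : List (Fin 3)) (x : ℝ) :
    compWord (piece ρ lam) w x = ρ ^ w.length * x + compWord (piece ρ lam) w 0 := by
  induction w generalizing x with
  | nil => simp [compWord]
  | cons i w ih =>
    rw [compWord_cons, compWord_cons, ih x]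
    simp only [piece, List.length_cons]
    ring

lemma compWord_replicate_zero (ρ lam : ℝ) (n : ℕ) :
    compWord (piece ρ lam) (List.replicate n 0) 0 = 0 := by
  induction n with
  | zero => rfl
  | succ n ih => rw [List.replicate_succ, compWord_cons, ih]; simp [piece]

lemma compWord_replicate_two (ρ lam : ℝ) (n : ℕ) :
    compWord (piece ρ lam) (List.replicate n 2) 1 = 1 := by
  induction n with
  | zero => rfl
  | succ n ih => rw [List.replicate_succ, compWord_cons, ih]; simp [piece]

lemma IsWord.cons {ρ lam r t : ℝ} (hρ : ρ ≠ 0) (i : Fin 3)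
    (h : IsWord ρ lam (r / ρ) ((t - shift ρ lam i) / ρ)) : IsWord ρ lam r t := by
  obtain ⟨w, hw⟩ := h
  refine ⟨i :: w, fun x => ?_⟩
  rw [compWord_cons, ← hw x, piece]
  field_simp
  ring

namespace IsAttractor

variable {ρ lam r t : ℝ} {E : Set ℝ}

lemma shift_nonneg (h : IsAttractor ρ lam E) (i : Fin 3) : 0 ≤ shift ρ lam i := by
  have := h.pos; have := h.lt_third; have := h.le_lam
  fin_cases i <;> simp <;> linarith

lemma shift_le (h : IsAttractor ρ lam E) (i : Fin 3) : shift ρ lam i ≤ 1 - ρ := by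
  have := h.pos; have := h.lt_third; have := h.lam_le
  fin_cases i <;> simp <;> linarith

lemma piece_mem_Icc (h : IsAttractor ρ lam E) (i : Fin 3) {x : ℝ} (h0 : 0 ≤ x) (h1 : x ≤ 1) :
    0 ≤ piece ρ lam i x ∧ piece ρ lam i x ≤ 1 := by
  have := h.shift_nonneg i; have := h.shift_le i; have := h.pos
  unfold piece
  constructor <;> nlinarith

lemma compWord_mem_Icc (h : IsAttractor ρ lam E) (w : List (Fin 3)) {x : ℝ}
    (h0 : 0 ≤ x) (h1 : x ≤ 1) :
    0 ≤ compWord (piece ρ lam) w x ∧ compWord (piece ρ lam) w x ≤ 1 := by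
  induction w with
  | nil => exact ⟨h0, h1⟩
  | cons i w ih => exact h.piece_mem_Icc i ih.1 ih.2

lemma of_piece_mem (h : IsAttractor ρ lam E) (i : Fin 3) {x : ℝ} (h0 : 0 ≤ x) (h1 : x ≤ 1)
    (hx : piece ρ lam i x ∈ E) : x ∈ E := by
  obtain ⟨j, y, hy, hxy⟩ := h.exists_piece _ hx
  have hy0 := h.nonneg y hy
  have hy1 := h.le_one y hy
  have := h.pos; have := h.lt_third; have := h.le_lam; have := h.lam_le
  have key : x = y ∨ x = 0 ∨ x = 1 := by
    unfold piece at hxy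
    fin_cases i <;> fin_cases j <;> simp at hxy
    all_goals first
      | (left; rcases hxy with h | h <;> linarith)
      | (right; left; nlinarith)
      | (right; right; nlinarith)
  rcases key with rfl | rfl | rfl
  · exact hy
  · exact h.zero_mem
  · exact h.one_mem

lemma of_compWord_mem (h : IsAttractor ρ lam E) (w : List (Fin 3)) {x : ℝ}
    (h0 : 0 ≤ x) (h1 : x ≤ 1) (hx : compWord (piece ρ lam) w x ∈ E) : x ∈ E := by
  induction w with
  | nil => exact hx
  | cons i w ih =>
    have hb := h.compWord_mem_Icc w h0 h1
    exact ih (h.of_piece_mem i hb.1 hb.2 hx)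

lemma location (h : IsAttractor ρ lam E) {x : ℝ} (hx : x ∈ E) :
    x ≤ ρ ∨ (lam ≤ x ∧ x ≤ lam + ρ) ∨ 1 - ρ ≤ x := by
  obtain ⟨j, y, hy, hxy⟩ := h.exists_piece _ hx
  have hy0 := h.nonneg y hy
  have hy1 := h.le_one y hy
  have := h.pos
  unfold piece at hxy
  fin_cases j <;> simp at hxy
  · left; nlinarith
  · right; left; constructor <;> nlinarith
  · right; right; nlinarith

lemma not_mem_right_gap (h : IsAttractor ρ lam E) {x : ℝ} (hx : x ∈ E)
    (h1 : lam + ρ < x) (h2 : x < 1 - ρ) : False := by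
  have := h.le_lam; have := h.pos
  rcases h.location hx with h' | h' | h' <;> linarith

lemma exists_small (h : IsAttractor ρ lam E) {ε : ℝ} (hε : 0 < ε) :
    ∃ e ∈ E, 0 < e ∧ e < ε := by
  obtain ⟨n, hn⟩ := exists_pow_lt_of_lt_one hε (show ρ < 1 by linarith [h.lt_third])
  refine ⟨ρ ^ n, ?_, pow_pos h.pos n, hn⟩
  clear hn
  induction n with
  | zero => simpa using h.one_mem
  | succ n ih =>
    have := h.piece_mem 0 _ ih
    simp only [piece, shift_zero, add_zero] at this
    rwa [pow_succ, mul_comm]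

lemma exists_near_one (h : IsAttractor ρ lam E) {ε : ℝ} (hε : 0 < ε) :
    ∃ e, 0 < e ∧ e < ε ∧ 1 - e ∈ E := by
  obtain ⟨n, hn⟩ := exists_pow_lt_of_lt_one hε (show ρ < 1 by linarith [h.lt_third])
  refine ⟨ρ ^ n, pow_pos h.pos n, hn, ?_⟩
  clear hn
  induction n with
  | zero => simpa using h.zero_mem
  | succ n ih =>
    have := h.piece_mem 2 _ ih
    simp only [piece, shift_two] at this
    convert this using 1
    ring

lemma mem_left (h : IsAttractor ρ lam E) {y : ℝ} (hy : y ∈ E) : ρ * y ∈ E := by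
  simpa [piece] using h.piece_mem 0 y hy

lemma mem_mid (h : IsAttractor ρ lam E) {y : ℝ} (hy : y ∈ E) : ρ * y + lam ∈ E := by
  simpa [piece] using h.piece_mem 1 y hy

lemma mem_right (h : IsAttractor ρ lam E) {y : ℝ} (hy : y ∈ E) : ρ * y + (1 - ρ) ∈ E := by
  simpa [piece] using h.piece_mem 2 y hy

lemma rho_mem (h : IsAttractor ρ lam E) : ρ ∈ E := by simpa using h.mem_left h.one_mem
lemma lam_mem (h : IsAttractor ρ lam E) : lam ∈ E := by simpa using h.mem_mid h.zero_mem
lemma lam_add_mem (h : IsAttractor ρ lam E) : lam + ρ ∈ E := by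
  simpa [add_comm] using h.mem_mid h.one_mem
lemma one_sub_mem (h : IsAttractor ρ lam E) : 1 - ρ ∈ E := by simpa using h.mem_right h.zero_mem

/-- If the right gap is at least as long as the left one, no gap of `E` is longer. -/
lemma gap_le (h : IsAttractor ρ lam E) (hab : 2 * lam ≤ 1 - ρ) {u v : ℝ} (hu : 0 ≤ u)
    (huv : u ≤ v) (hv : v ≤ 1) (hgap : ∀ x ∈ E, ¬ (u < x ∧ x < v)) :
    v - u ≤ 1 - 2 * ρ - lam := by
  have hρ := h.pos; have hρ3 := h.lt_third; have hl1 := h.le_lam; have hl2 := h.lam_le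
  have main : ∀ n : ℕ, ∀ u v : ℝ, 0 ≤ u → u ≤ v → v ≤ 1 → (∀ x ∈ E, ¬ (u < x ∧ x < v)) →
      v - u ≤ 1 - 2 * ρ - lam ∨ v - u ≤ ρ ^ n := by
    intro n
    induction n with
    | zero => intro u v hu huv hv _; right; simp; linarith
    | succ n ih =>
      intro u v hu huv hv hgap
      have pull : ∀ i, shift ρ lam i ≤ u → v ≤ shift ρ lam i + ρ →
          v - u ≤ 1 - 2 * ρ - lam ∨ v - u ≤ ρ ^ (n + 1) := by
        intro i h1 h2
        have hd : (v - shift ρ lam i) / ρ - (u - shift ρ lam i) / ρ = (v - u) / ρ := by ring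
        rcases ih ((u - shift ρ lam i) / ρ) ((v - shift ρ lam i) / ρ)
          (div_nonneg (by linarith) hρ.le) (by gcongr)
          ((div_le_one hρ).2 (by linarith)) (fun x hx hux => by
            have h3 := (div_lt_iff₀ hρ).1 hux.1
            have h4 := (lt_div_iff₀ hρ).1 hux.2
            refine hgap _ (h.piece_mem i x hx) ⟨?_, ?_⟩ <;> unfold piece <;> linarith) with h5 | h5
        · left
          rw [hd, div_le_iff₀ hρ] at h5
          nlinarith
        · right
          rw [hd, div_le_iff₀ hρ] at h5
          rwa [pow_succ]
      have side : ∀ x ∈ E, x ≤ u ∨ v ≤ x := fun x hx => by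
        by_contra hc
        push Not at hc
        exact hgap x hx hc
      rcases side _ h.rho_mem with h1 | h1
      · rcases side _ h.lam_mem with h2 | h2
        · rcases side _ h.lam_add_mem with h3 | h3
          · rcases side _ h.one_sub_mem with h4 | h4
            · exact pull 2 (by simpa using h4) (by simpa using hv)
            · left; linarith
          · exact pull 1 (by simpa using h2) (by simpa using h3)
        · left; linarith
      · exact pull 0 (by simpa using hu) (by simpa using h1)
  by_contra hc
  push Not at hc
  obtain ⟨n, hn⟩ := exists_pow_lt_of_lt_one (show 0 < v - u by linarith)
    (show ρ < 1 by linarith)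
  rcases main n u v hu huv hv hgap with h1 | h1 <;> linarith

lemma maps_div (h : IsAttractor ρ lam E) (hf : Maps E r t) (i : Fin 3)
    (h0 : shift ρ lam i ≤ t ∧ t ≤ shift ρ lam i + ρ)
    (h1 : shift ρ lam i ≤ r + t ∧ r + t ≤ shift ρ lam i + ρ) :
    Maps E (r / ρ) ((t - shift ρ lam i) / ρ) := by
  intro x hx
  have hρ := h.pos
  have hx0 := h.nonneg x hx; have hx1 := h.le_one x hx
  have e : r / ρ * x + (t - shift ρ lam i) / ρ = (r * x + t - shift ρ lam i) / ρ := by ring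
  apply h.of_piece_mem i
  · rw [e]; apply div_nonneg _ hρ.le; nlinarith
  · rw [e, div_le_one hρ]; nlinarith
  · convert hf x hx using 1
    unfold piece; field_simp; ring

/-- If the image of the `j`-th piece lies in the `i`-th one, renormalising preserves the ratio. -/
lemma maps_child (h : IsAttractor ρ lam E) (hf : Maps E r t) (i j : Fin 3)
    (h0 : shift ρ lam i ≤ r * shift ρ lam j + t ∧ r * shift ρ lam j + t ≤ shift ρ lam i + ρ)
    (h1 : shift ρ lam i ≤ r * (shift ρ lam j + ρ) + t ∧
      r * (shift ρ lam j + ρ) + t ≤ shift ρ lam i + ρ) :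
    Maps E r ((t + r * shift ρ lam j - shift ρ lam i) / ρ) := by
  have hc : Maps E (r * ρ) (r * shift ρ lam j + t) := fun x hx => by
    have := hf _ (h.piece_mem j x hx)
    unfold piece at this
    convert this using 1
    ring
  have := h.maps_div hc i h0 ⟨by linarith [h1.1], by linarith [h1.2]⟩
  rw [mul_div_cancel_right₀ _ h.pos.ne'] at this
  convert this using 2
  ring

lemma gap_piece (h : IsAttractor ρ lam E) (i : Fin 3) {p q : ℝ} (hp : 0 ≤ p) (hq : q ≤ 1)
    (hgap : ∀ y ∈ E, ¬ (p < y ∧ y < q)) :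
    ∀ y ∈ E, ¬ (piece ρ lam i p < y ∧ y < piece ρ lam i q) := by
  rintro y hy ⟨h1, h2⟩
  have hρ := h.pos
  unfold piece at h1 h2
  have h3 : p < (y - shift ρ lam i) / ρ := by rw [lt_div_iff₀ hρ]; linarith
  have h4 : (y - shift ρ lam i) / ρ < q := by rw [div_lt_iff₀ hρ]; linarith
  refine hgap _ (h.of_piece_mem i (by linarith) (by linarith) ?_) ⟨h3, h4⟩
  convert hy using 1
  unfold piece; field_simp; ring

/-- What lies immediately to the left of a cylinder: nothing, a gap which is relatively longer
than the right gap of `E`, or a gap followed by a cylinder of the same generation. -/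
lemma left_neighbor (h : IsAttractor ρ lam E) (hb : 0 < 1 - 2 * ρ - lam) (u : List (Fin 3)) :
    compWord (piece ρ lam) u 0 = 0 ∨
    (∃ β, 1 - 2 * ρ - lam < β ∧ 0 ≤ compWord (piece ρ lam) u 0 - ρ ^ u.length * β ∧
      ∀ y ∈ E, ¬ (compWord (piece ρ lam) u 0 - ρ ^ u.length * β < y ∧
        y < compWord (piece ρ lam) u 0)) ∨
    (∃ G, 0 ≤ G ∧ ∃ v : List (Fin 3), v.length = u.length ∧
      compWord (piece ρ lam) v 1 = compWord (piece ρ lam) u 0 - ρ ^ u.length * G ∧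
      ∀ y ∈ E, ¬ (compWord (piece ρ lam) u 0 - ρ ^ u.length * G < y ∧
        y < compWord (piece ρ lam) u 0)) := by
  have hρ := h.pos; have hρ3 := h.lt_third; have hl := h.le_lam
  induction u with
  | nil => left; rfl
  | cons i u ih =>
    have hs : 0 < ρ ^ (u.length + 1) := pow_pos hρ _
    have hs1 : ρ ^ (u.length + 1) < 1 := pow_lt_one₀ hρ.le (by linarith) (by simp)
    have hx := h.compWord_mem_Icc u le_rfl zero_le_one
    have hexp : ∀ c, piece ρ lam i (compWord (piece ρ lam) u 0 - ρ ^ u.length * c) =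
        compWord (piece ρ lam) (i :: u) 0 - ρ ^ (u.length + 1) * c := fun c => by
      rw [compWord_cons, pow_succ]; unfold piece; ring
    rw [List.length_cons]
    rcases ih with h0 | ⟨β, hβ, hβ0, hgap⟩ | ⟨G, hG, v, hv, hv1, hgap⟩
    · have hx0 : compWord (piece ρ lam) (i :: u) 0 = shift ρ lam i := by
        rw [compWord_cons, h0]; simp [piece]
      rw [hx0]
      obtain rfl | rfl | rfl : i = 0 ∨ i = 1 ∨ i = 2 := by fin_cases i <;> simp
      · left; rfl
      · right; right
        refine ⟨(lam - ρ) / ρ ^ (u.length + 1), by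
            apply div_nonneg _ hs.le; linarith,
          0 :: List.replicate u.length 2, by simp, ?_, ?_⟩
        · rw [compWord_cons, compWord_replicate_two]
          rw [mul_div_cancel₀ _ hs.ne']
          simp [piece]
        · intro y hy
          rw [mul_div_cancel₀ _ hs.ne']
          simp only [shift_one]
          rintro ⟨h1, h2⟩
          rcases h.location hy with h' | h' | h' <;> linarith [h.lam_le]
      · right; left
        refine ⟨(1 - 2 * ρ - lam) / ρ ^ (u.length + 1), ?_, ?_, ?_⟩
        · rw [lt_div_iff₀ hs]
          exact mul_lt_of_lt_one_right hb hs1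
        · rw [mul_div_cancel₀ _ hs.ne']
          simp only [shift_two]
          linarith
        · intro y hy
          rw [mul_div_cancel₀ _ hs.ne']
          simp only [shift_two]
          rintro ⟨h1, h2⟩
          exact h.not_mem_right_gap hy (by linarith) h2
    · right; left
      refine ⟨β, hβ, ?_, ?_⟩
      · rw [← hexp]
        exact (h.piece_mem_Icc i hβ0
          (by nlinarith [pow_pos hρ u.length])).1
      · rw [← hexp]
        exact h.gap_piece i hβ0 hx.2 hgap
    · right; right
      refine ⟨G, hG, i :: v, by simp [hv], ?_, ?_⟩
      · rw [compWord_cons, hv1, hexp]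
      · rw [← hexp]
        exact h.gap_piece i (hv1 ▸ (h.compWord_mem_Icc v zero_le_one le_rfl).1) hx.2 hgap

/-- What lies immediately to the right of a cylinder. -/
lemma right_neighbor (h : IsAttractor ρ lam E) (hb : 0 < 1 - 2 * ρ - lam) (u : List (Fin 3)) :
    compWord (piece ρ lam) u 1 = 1 ∨
    (∃ β, 1 - 2 * ρ - lam < β ∧ compWord (piece ρ lam) u 1 + ρ ^ u.length * β ≤ 1 ∧
      ∀ y ∈ E, ¬ (compWord (piece ρ lam) u 1 < y ∧
        y < compWord (piece ρ lam) u 1 + ρ ^ u.length * β)) ∨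
    (∃ G, 0 ≤ G ∧ ∃ v : List (Fin 3), v.length = u.length ∧
      compWord (piece ρ lam) v 0 = compWord (piece ρ lam) u 1 + ρ ^ u.length * G ∧
      ∀ y ∈ E, ¬ (compWord (piece ρ lam) u 1 < y ∧
        y < compWord (piece ρ lam) u 1 + ρ ^ u.length * G)) := by
  have hρ := h.pos; have hρ3 := h.lt_third; have hl := h.le_lam
  induction u with
  | nil => left; rfl
  | cons i u ih =>
    have hs : 0 < ρ ^ (u.length + 1) := pow_pos hρ _
    have hs1 : ρ ^ (u.length + 1) < 1 := pow_lt_one₀ hρ.le (by linarith) (by simp)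
    have hx := h.compWord_mem_Icc u zero_le_one le_rfl
    have hexp : ∀ c, piece ρ lam i (compWord (piece ρ lam) u 1 + ρ ^ u.length * c) =
        compWord (piece ρ lam) (i :: u) 1 + ρ ^ (u.length + 1) * c := fun c => by
      rw [compWord_cons, pow_succ]; unfold piece; ring
    rw [List.length_cons]
    rcases ih with h0 | ⟨β, hβ, hβ0, hgap⟩ | ⟨G, hG, v, hv, hv1, hgap⟩
    · have hx0 : compWord (piece ρ lam) (i :: u) 1 = ρ + shift ρ lam i := by
        rw [compWord_cons, h0]; simp [piece]
      rw [hx0]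
      obtain rfl | rfl | rfl : i = 0 ∨ i = 1 ∨ i = 2 := by fin_cases i <;> simp
      · right; right
        refine ⟨(lam - ρ) / ρ ^ (u.length + 1), by
            apply div_nonneg _ hs.le; linarith,
          1 :: List.replicate u.length 0, by simp, ?_, ?_⟩
        · rw [compWord_cons, compWord_replicate_zero]
          rw [mul_div_cancel₀ _ hs.ne']
          simp [piece]
        · intro y hy
          rw [mul_div_cancel₀ _ hs.ne']
          simp only [shift_zero]
          rintro ⟨h1, h2⟩
          rcases h.location hy with h' | h' | h' <;> linarith [h.lam_le]
      · right; left
        refine ⟨(1 - 2 * ρ - lam) / ρ ^ (u.length + 1), ?_, ?_, ?_⟩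
        · rw [lt_div_iff₀ hs]
          exact mul_lt_of_lt_one_right hb hs1
        · rw [mul_div_cancel₀ _ hs.ne']
          simp only [shift_one]
          linarith
        · intro y hy
          rw [mul_div_cancel₀ _ hs.ne']
          simp only [shift_one]
          rintro ⟨h1, h2⟩
          exact h.not_mem_right_gap hy (by linarith) (by linarith)
      · left; simp
    · right; left
      refine ⟨β, hβ, ?_, ?_⟩
      · rw [← hexp]
        exact (h.piece_mem_Icc i (by nlinarith [pow_pos hρ u.length]) hβ0).2
      · rw [← hexp]
        exact h.gap_piece i hx.1 hβ0 hgap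
    · right; right
      refine ⟨G, hG, i :: v, by simp [hv], ?_, ?_⟩
      · rw [compWord_cons, hv1, hexp]
      · rw [← hexp]
        exact h.gap_piece i hx.1 (hv1 ▸ (h.compWord_mem_Icc v le_rfl zero_le_one).2) hgap

/-- A map preserving `E` that sends some piece onto a cylinder is itself a cylinder map. -/
lemma isWord_of_comp_piece (h : IsAttractor ρ lam E) (hab : 2 * lam < 1 - ρ)
    (hf : Maps E r t) (hr : r < 1) (j : Fin 3) (w : List (Fin 3))
    (hw : ∀ x, r * piece ρ lam j x + t = compWord (piece ρ lam) w x) : IsWord ρ lam r t := by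
  have hρ := h.pos; have hρ3 := h.lt_third; have hl1 := h.le_lam; have hl2 := h.lam_le
  have hb : 0 < 1 - 2 * ρ - lam := by linarith
  rcases List.eq_nil_or_concat' w with rfl | ⟨u, l, rfl⟩
  · exfalso
    have h0 := hw 0
    have h1 := hw 1
    simp only [piece, compWord, List.foldr_nil, id] at h0 h1
    nlinarith
  obtain ⟨ε, hε, hε1, hε2⟩ := h.exists_small (show 0 < (1 - ρ - 2 * lam) / 2 by linarith)
  obtain ⟨δ, hδ1, hδ2, hδ⟩ := h.exists_near_one (show 0 < (1 - ρ - 2 * lam) / 2 by linarith)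
  set s := ρ ^ u.length with hs
  have hs0 : 0 < s := pow_pos hρ _
  set x := compWord (piece ρ lam) u 0 with hx
  have hcyl : ∀ z, compWord (piece ρ lam) u z = s * z + x := compWord_piece ρ lam u
  have hform : ∀ z, r * z + t = s * (z - shift ρ lam j + shift ρ lam l) + x := by
    intro z
    have := hw ((z - shift ρ lam j) / ρ)
    rw [compWord_append, hcyl, compWord_cons] at this
    simp only [piece, compWord, List.foldr_nil, id, mul_div_cancel₀ _ hρ.ne'] at this
    linarith
  have hfE : ∀ e ∈ E, s * (e - shift ρ lam j + shift ρ lam l) + x ∈ E := fun e he =>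
    hform e ▸ hf e he
  have hH : ∀ e ∈ E, 0 ≤ e - shift ρ lam j + shift ρ lam l →
      e - shift ρ lam j + shift ρ lam l ≤ 1 → e - shift ρ lam j + shift ρ lam l ∈ E :=
    fun e he h0 h1 => h.of_compWord_mem u h0 h1 (by rw [hcyl]; exact hfE e he)
  by_cases hjl : j = l
  · subst hjl
    refine ⟨u, fun z => ?_⟩
    rw [hform, hcyl]
    ring
  exfalso
  have hρε : ρ * ε < ε := by nlinarith
  have hρδ : ρ * δ < δ := by nlinarith
  have hρε0 : 0 < ρ * ε := by positivity
  have hρδ0 : 0 < ρ * δ := by positivity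
  have m1 := h.mem_mid hε
  have m2 := h.mem_right hδ
  have m3 := h.mem_left hδ
  fin_cases j <;> fin_cases l <;> simp at hjl hH hfE
  · have := hH _ m1 (by linarith) (by linarith)
    exact h.not_mem_right_gap this (by linarith) (by linarith)
  · rcases h.right_neighbor hb u with h0 | ⟨β, hβ, hβ0, hgap⟩ | ⟨G, hG, v, hv, hv1, hgap⟩
    · have := h.le_one _ (hfE 1 h.one_mem)
      rw [hcyl] at h0
      nlinarith
    · rw [hcyl] at hgap
      refine hgap _ (hfE _ m1) ⟨?_, ?_⟩ <;> rw [← hs] at * <;> nlinarith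
    · rw [hcyl, ← hs] at hgap hv1
      have hG2 : G ≤ ρ * ε + lam - ρ := by
        by_contra hc
        push Not at hc
        refine hgap _ (hfE _ m1) ⟨?_, ?_⟩ <;> nlinarith
      have hH2 : ∀ e ∈ E, 0 ≤ e - ρ - G → e - ρ - G ≤ 1 → e - ρ - G ∈ E :=
        fun e he h0 h1 => h.of_compWord_mem v h0 h1 (by
          rw [compWord_piece, hv1, hv, ← hs]
          convert hfE e he using 1
          ring)
      have := hH2 _ hδ (by linarith) (by linarith)
      exact h.not_mem_right_gap this (by linarith) (by linarith)
  · have := hH _ m2 (by linarith) (by linarith)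
    exact h.not_mem_right_gap this (by linarith) (by linarith)
  · have := hH _ m3 (by linarith) (by linarith)
    exact h.not_mem_right_gap this (by linarith) (by linarith)
  · have hneg := h.nonneg _ (hfE 0 h.zero_mem)
    rcases h.left_neighbor hb u with h0 | ⟨β, hβ, hβ0, hgap⟩ | ⟨G, hG, v, hv, hv1, hgap⟩
    · rw [← hx] at h0
      nlinarith
    · rw [← hx, ← hs] at hgap
      refine hgap _ (hfE _ h.lam_add_mem) ⟨?_, ?_⟩ <;> nlinarith
    · rw [← hx, ← hs] at hgap hv1
      have hG2 : G ≤ 1 - 2 * ρ - lam := by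
        by_contra hc
        push Not at hc
        refine hgap _ (hfE _ h.lam_add_mem) ⟨?_, ?_⟩ <;> nlinarith
      have hH2 : ∀ e ∈ E, 0 ≤ e + ρ + G → e + ρ + G ≤ 1 → e + ρ + G ∈ E :=
        fun e he h0 h1 => h.of_compWord_mem v h0 h1 (by
          rw [compWord_piece, hv, ← hs]
          rw [compWord_piece, hv, ← hs] at hv1
          convert hfE e he using 1
          linear_combination hv1)
      rcases hG.eq_or_lt with h0 | h0
      · have := hH2 _ m1 (by linarith) (by linarith)
        exact h.not_mem_right_gap this (by linarith) (by linarith)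
      · have hG3 : 1 - 2 * ρ - lam ≤ G := by
          by_contra hc
          push Not at hc
          exact h.not_mem_right_gap (hH2 _ h.lam_mem (by linarith) (by linarith))
            (by linarith) (by linarith)
        exact h.not_mem_right_gap (hH2 _ m3 (by linarith) (by linarith))
          (by linarith) (by linarith)
  · have hneg := h.nonneg _ (hfE 0 h.zero_mem)
    rcases h.left_neighbor hb u with h0 | ⟨β, hβ, hβ0, hgap⟩ | ⟨G, hG, v, hv, hv1, hgap⟩
    · rw [← hx] at h0
      nlinarith
    · rw [← hx, ← hs] at hgap
      refine hgap _ (hfE _ h.lam_mem) ⟨?_, ?_⟩ <;> nlinarith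
    · rw [← hx, ← hs] at hgap hv1
      have hG2 : G ≤ 1 - ρ - 2 * lam - ρ * ε := by
        by_contra hc
        push Not at hc
        refine hgap _ (hfE _ m1) ⟨?_, ?_⟩ <;> nlinarith
      have hH2 : ∀ e ∈ E, 0 ≤ e + lam + ρ + G → e + lam + ρ + G ≤ 1 → e + lam + ρ + G ∈ E :=
        fun e he h0 h1 => h.of_compWord_mem v h0 h1 (by
          rw [compWord_piece, hv, ← hs]
          rw [compWord_piece, hv, ← hs] at hv1
          convert hfE e he using 1
          linear_combination hv1)
      have m4 := h.mem_left (h.mem_left hε)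
      have h4 : ρ * (ρ * ε) < ρ * ε := by nlinarith
      have h5 : 0 < ρ * (ρ * ε) := by positivity
      exact h.not_mem_right_gap (hH2 _ m4 (by linarith) (by linarith))
        (by linarith) (by linarith)

lemma maps_mem_zero (h : IsAttractor ρ lam E) (hf : Maps E r t) : t ∈ E := by
  simpa using hf 0 h.zero_mem

lemma maps_mem_one (h : IsAttractor ρ lam E) (hf : Maps E r t) : r + t ∈ E := by
  simpa using hf 1 h.one_mem

/-- The image of `E` under a contraction cannot jump over a longest gap of `E`. -/
lemma not_straddle (h : IsAttractor ρ lam E) (hab : 2 * lam ≤ 1 - ρ) (hf : Maps E r t)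
    (hr0 : r ≠ 0) (hr1 : |r| < 1) {p q : ℝ} (hpq : 1 - 2 * ρ - lam ≤ q - p)
    (hgap : ∀ x ∈ E, ¬ (p < x ∧ x < q)) :
    (t ≤ p ∧ r + t ≤ p) ∨ (q ≤ t ∧ q ≤ r + t) := by
  have hb : 0 < 1 - 2 * ρ - lam := by linarith [h.lt_third]
  have side : ∀ x ∈ E, x ≤ p ∨ q ≤ x := fun x hx => by
    by_contra hc
    push Not at hc
    exact hgap x hx hc
  have hinv : ∀ x, r * ((x - t) / r) + t = x := fun x => by field_simp; ring
  obtain ⟨hlo, hhi⟩ := abs_lt.1 hr1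
  rcases side _ (h.maps_mem_zero hf) with h0 | h0 <;>
    rcases side _ (h.maps_mem_one hf) with h1 | h1
  · exact Or.inl ⟨h0, h1⟩
  · exfalso
    have hr : 0 < r := by linarith
    have := h.gap_le hab (u := (p - t) / r) (v := (q - t) / r)
      (div_nonneg (by linarith) hr.le) (by gcongr; linarith)
      ((div_le_one hr).2 (by linarith)) (fun x hx hux => by
        have h3 := (div_lt_iff₀ hr).1 hux.1
        have h4 := (lt_div_iff₀ hr).1 hux.2
        exact hgap _ (hf x hx) ⟨by linarith, by linarith⟩)
    rw [← sub_div, div_le_iff₀ hr] at this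
    nlinarith
  · exfalso
    have hr : r < 0 := by linarith
    have := h.gap_le hab (u := (q - t) / r) (v := (p - t) / r)
      (div_nonneg_of_nonpos (by linarith) hr.le)
      (div_le_div_of_nonpos_of_le hr.le (by linarith))
      ((div_le_one_of_neg hr).2 (by linarith)) (fun x hx hux => by
        have h3 := (div_lt_iff_of_neg hr).1 hux.1
        have h4 := (lt_div_iff_of_neg hr).1 hux.2
        exact hgap _ (hf x hx) ⟨by linarith, by linarith⟩)
    rw [← sub_div, div_le_iff_of_neg hr] at this
    nlinarith
  · exact Or.inr ⟨h0, h1⟩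

/-- A contraction preserving `E` maps it into the last piece or into the first two. -/
lemma last_or_first_two (h : IsAttractor ρ lam E) (hab : 2 * lam ≤ 1 - ρ) (hf : Maps E r t)
    (hr0 : r ≠ 0) (hr1 : |r| < 1) :
    (t ≤ lam + ρ ∧ r + t ≤ lam + ρ) ∨ (1 - ρ ≤ t ∧ 1 - ρ ≤ r + t) :=
  h.not_straddle hab hf hr0 hr1 (by linarith) fun _ hx hc => h.not_mem_right_gap hx hc.1 hc.2

lemma le_or_ge_of_le (h : IsAttractor ρ lam E) (hab : 2 * lam ≤ 1 - ρ) {x : ℝ} (hx : x ∈ E)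
    (hx1 : x ≤ lam + ρ) : x ≤ ρ ∨ lam ≤ x := by
  have := h.lt_third
  rcases h.location hx with h' | h' | h'
  · exact Or.inl h'
  · exact Or.inr h'.1
  · exact Or.inr (by linarith)

/-- Induction step for orientation preserving maps, from ratio `r / ρ` to ratio `r`. -/
lemma isWord_of_isWord_div (h : IsAttractor ρ lam E) (hab : 2 * lam < 1 - ρ)
    (hr0 : 0 < r) (hr1 : r < 1) (ih : ∀ t, Maps E (r / ρ) t → IsWord ρ lam (r / ρ) t)
    (hf : Maps E r t) : IsWord ρ lam r t := by
  have hρ := h.pos; have hρ3 := h.lt_third; have hl1 := h.le_lam; have hl2 := h.lam_le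
  by_contra hnot
  set B : Set ℝ := {t | Maps E r t ∧ ¬ IsWord ρ lam r t}
  have hne : B.Nonempty := ⟨t, hf, hnot⟩
  have inpiece : ∀ t ∈ B, ∀ i, shift ρ lam i ≤ t → r + t ≤ shift ρ lam i + ρ → False :=
    fun t ht i h0 h1 => ht.2 (IsWord.cons hρ.ne' i
      (ih _ (h.maps_div ht.1 i ⟨h0, by linarith⟩ ⟨by linarith, h1⟩)))
  have child : ∀ t ∈ B, ∀ i j, shift ρ lam i ≤ r * shift ρ lam j + t →
      r * (shift ρ lam j + ρ) + t ≤ shift ρ lam i + ρ →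
      (t + r * shift ρ lam j - shift ρ lam i) / ρ ∈ B := by
    intro t ht i j h0 h1
    have := mul_pos hr0 hρ
    refine ⟨h.maps_child ht.1 i j ⟨h0, by linarith⟩ ⟨by linarith, h1⟩, fun ⟨w, hw⟩ => ht.2 ?_⟩
    refine h.isWord_of_comp_piece hab ht.1 hr1 j (i :: w) fun x => ?_
    rw [compWord_cons, ← hw]
    unfold piece
    field_simp
    ring
  have bounds : ∀ t ∈ B, 0 ≤ t ∧ t ≤ ρ ∧ lam ≤ r + t ∧ r + t ≤ lam + ρ := by
    intro t ht
    have m0 := h.maps_mem_zero ht.1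
    have m1 := h.maps_mem_one ht.1
    rcases h.last_or_first_two hab.le ht.1 hr0.ne' (by rwa [abs_of_pos hr0]) with hh | hh
    · refine ⟨h.nonneg _ m0, ?_, ?_, hh.2⟩
      · rcases h.le_or_ge_of_le hab.le m0 hh.1 with h' | h'
        · exact h'
        · exact (inpiece t ht 1 h' hh.2).elim
      · rcases h.le_or_ge_of_le hab.le m1 hh.2 with h' | h'
        · exact (inpiece t ht 0 (h.nonneg _ m0) (by simpa using h')).elim
        · exact h'
    · exact (inpiece t ht 2 hh.1 (by simpa using h.le_one _ m1)).elim
  have types : ∀ t ∈ B,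
      (t / ρ ∈ B ∧ (t + r * (1 - ρ) - lam) / ρ ∈ B ∧
        ((t + r * lam) / ρ ∈ B ∨ lam ≤ r * (lam + ρ) + t)) ∨
      (lam ≤ r * ρ + t ∧ (t + r * lam - lam) / ρ ∈ B ∧ (t + r * (1 - ρ) - lam) / ρ ∈ B) ∨
      (t / ρ ∈ B ∧ (t + r * lam) / ρ ∈ B) := by
    intro t ht
    obtain ⟨b0, b1, b2, b3⟩ := bounds t ht
    have side : ∀ x ∈ E, r * x + t ≤ ρ ∨ lam ≤ r * x + t := fun x hx =>
      h.le_or_ge_of_le hab.le (ht.1 x hx) (by nlinarith [h.le_one x hx])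
    have c00 := child t ht 0 0
    have c01 := child t ht 0 1
    have c11 := child t ht 1 1
    have c12 := child t ht 1 2
    simp only [shift_zero, shift_one, shift_two, mul_zero, zero_add, sub_zero, add_zero] at *
    rcases side _ h.rho_mem with h1 | h1
    · have d00 := c00 b0 h1
      rcases side _ h.one_sub_mem with h2 | h2
      · right; right
        exact ⟨d00, c01 (by nlinarith) (by nlinarith)⟩
      · left
        refine ⟨d00, c12 h2 (by linarith), ?_⟩
        rcases side _ h.lam_add_mem with h3 | h3
        · exact Or.inl (c01 (by nlinarith) h3)
        · exact Or.inr h3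
    · right; left
      exact ⟨h1, c11 (by nlinarith) (by nlinarith), c12 (by nlinarith) (by linarith)⟩
  have hbdd : BddAbove B := ⟨ρ, fun t ht => (bounds t ht).2.1⟩
  have hbddb : BddBelow B := ⟨0, fun t ht => (bounds t ht).1⟩
  set M := sSup B
  set m := sInf B
  have hM : ∀ t ∈ B, t ≤ M := fun t ht => le_csSup hbdd ht
  have hm : ∀ t ∈ B, m ≤ t := fun t ht => csInf_le hbddb ht
  have hMd : ∀ s, s / ρ ∈ B → s ≤ ρ * M := fun s hs => by
    have := hM _ hs
    rw [div_le_iff₀ hρ] at this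
    linarith
  have hmd : ∀ s, s / ρ ∈ B → ρ * m ≤ s := fun s hs => by
    have := hm _ hs
    rw [le_div_iff₀ hρ] at this
    linarith
  have hmM : m ≤ M := by
    obtain ⟨t, ht⟩ := hne
    exact (hm t ht).trans (hM t ht)
  have hr1ρ : 0 < r * (1 - ρ - lam) := mul_pos hr0 (by linarith)
  have hrlam : 0 < r * lam := mul_pos hr0 (by linarith)
  -- the supremum is positive
  have hMpos : 0 < M := by
    by_contra hc
    obtain ⟨t, ht⟩ := hne
    have z : ∀ s, s / ρ ∈ B → s = 0 := fun s hs => by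
      have h1 := hMd s hs
      have h2 := (bounds _ hs).1
      have h3 : 0 ≤ s := by
        by_contra h4
        push Not at h4
        linarith [div_neg_of_neg_of_pos h4 hρ]
      nlinarith
    have ht0 : t = 0 := le_antisymm ((hM t ht).trans (not_lt.1 hc)) (bounds t ht).1
    subst ht0
    rcases types 0 ht with ⟨-, h2, h3 | h3⟩ | ⟨-, h2, h3⟩ | ⟨-, h3⟩
    · linarith [z _ h3]
    · have := z _ h2
      have : 0 < r * (1 - ρ - (lam + ρ)) := mul_pos hr0 (by linarith)
      linarith
    · linarith [z _ h2, z _ h3]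
    · linarith [z _ h3]
  have top : ∀ t ∈ B, ρ * M < t → lam ≤ r * ρ + t ∧ (t + r * lam - lam) / ρ ∈ B ∧
      (t + r * (1 - ρ) - lam) / ρ ∈ B := by
    intro t ht hlt
    rcases types t ht with ⟨h1, -⟩ | h1 | ⟨h1, -⟩
    · linarith [hMd _ h1]
    · exact h1
    · linarith [hMd _ h1]
  obtain ⟨t₀, ht₀, hlt₀⟩ := exists_lt_of_lt_csSup hne (show ρ * M < M by nlinarith)
  obtain ⟨ha, hc2, hc3⟩ := top t₀ ht₀ hlt₀
  have hMle : (1 - ρ) * M ≤ lam - r * (1 - ρ) := by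
    by_contra hc
    push Not at hc
    obtain ⟨t, ht, hlt⟩ := exists_lt_of_lt_csSup hne
      (show max (ρ * M) (lam - r * (1 - ρ) + ρ * M) < M from
        max_lt (by nlinarith) (by linarith))
    obtain ⟨-, -, h3⟩ := top t ht ((le_max_left _ _).trans_lt hlt)
    linarith [hMd _ h3, (le_max_right _ _).trans_lt hlt]
  rcases hmM.lt_or_eq with hlt | heq
  · obtain ⟨t, ht, htlt⟩ := exists_lt_of_csInf_lt hne
      (show m < min (lam * (1 - r) + ρ * m) (lam - r * (1 - ρ) + ρ * m) from
        lt_min (by nlinarith) (by nlinarith))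
    have u1 := htlt.trans_le (min_le_left _ _)
    have u2 := htlt.trans_le (min_le_right _ _)
    rcases types t ht with ⟨-, h3, -⟩ | ⟨-, h2, -⟩ | ⟨-, h3⟩
    · linarith [hmd _ h3]
    · linarith [hmd _ h2]
    · have e1 := hMd _ h3
      have e2 := (bounds t ht).2.2.1
      have e3 := hM _ ht₀
      have e4 : (1 - ρ) * (lam - r * ρ) ≤ lam - r * (1 - ρ) := by nlinarith
      have e5 : (1 - ρ) * (lam - r + r * lam) ≤ ρ * (lam - r * (1 - ρ)) := by
        nlinarith
      have e6 : lam * (1 - 2 * ρ) ≤ r * (1 - ρ) * (1 - lam - ρ) := by linarith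
      have e7 : r * (1 - ρ) * (1 - ρ) ≤ ρ * lam := by linarith
      have e8 : r * (1 - ρ) * (1 - ρ) * (1 - lam - ρ) ≤ ρ * lam * (1 - lam - ρ) :=
        mul_le_mul_of_nonneg_right e7 (by linarith)
      have e9 : lam * (1 - 2 * ρ) * (1 - ρ) ≤ r * (1 - ρ) * (1 - lam - ρ) * (1 - ρ) :=
        mul_le_mul_of_nonneg_right e6 (by linarith)
      have e10 : lam * (ρ * (1 - lam - ρ)) < lam * ((1 - 2 * ρ) * (1 - ρ)) :=
        mul_lt_mul_of_pos_left (by nlinarith) (by linarith)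
      linarith
  · have e1 := hM _ hc2
    have e2 := hm _ hc2
    have e3 := hM _ hc3
    have e4 := hm _ hc3
    have : (t₀ + r * lam - lam) / ρ = (t₀ + r * (1 - ρ) - lam) / ρ := by linarith
    rw [div_left_inj' hρ.ne'] at this
    linarith

/-- Induction step for orientation reversing maps, from ratio `r / ρ` to ratio `r`. -/
lemma not_maps_neg_of_div (h : IsAttractor ρ lam E) (hab : 2 * lam < 1 - ρ)
    (hr0 : 0 < r) (hr1 : r < 1) (ih : ∀ t, ¬ Maps E (-r / ρ) t) : ¬ Maps E (-r) t := by
  have hρ := h.pos; have hρ3 := h.lt_third; have hl1 := h.le_lam; have hl2 := h.lam_le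
  intro hf
  set B : Set ℝ := {t | Maps E (-r) t}
  have hne : B.Nonempty := ⟨t, hf⟩
  have inpiece : ∀ t ∈ B, ∀ i, shift ρ lam i ≤ -r + t → t ≤ shift ρ lam i + ρ → False :=
    fun t ht i h0 h1 => ih _ (h.maps_div ht i ⟨by linarith, h1⟩ ⟨h0, by linarith⟩)
  have child : ∀ t ∈ B, ∀ i j, shift ρ lam i ≤ -r * (shift ρ lam j + ρ) + t →
      -r * shift ρ lam j + t ≤ shift ρ lam i + ρ →
      (t + -r * shift ρ lam j - shift ρ lam i) / ρ ∈ B := by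
    intro t ht i j h0 h1
    have := mul_pos hr0 hρ
    exact h.maps_child ht i j ⟨by linarith, h1⟩ ⟨h0, by linarith⟩
  have bounds : ∀ t ∈ B, lam ≤ t ∧ t ≤ lam + ρ ∧ 0 ≤ -r + t ∧ -r + t ≤ ρ := by
    intro t ht
    have m0 := h.maps_mem_zero ht
    have m1 := h.maps_mem_one ht
    rcases h.last_or_first_two hab.le ht (neg_ne_zero.2 hr0.ne')
      (by rwa [abs_neg, abs_of_pos hr0]) with hh | hh
    · refine ⟨?_, hh.1, h.nonneg _ m1, ?_⟩
      · rcases h.le_or_ge_of_le hab.le m0 hh.1 with h' | h'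
        · exact (inpiece t ht 0 (h.nonneg _ m1) (by simpa using h')).elim
        · exact h'
      · rcases h.le_or_ge_of_le hab.le m1 hh.2 with h' | h'
        · exact h'
        · exact (inpiece t ht 1 h' hh.1).elim
    · exact (inpiece t ht 2 hh.2 (by simpa using h.le_one _ m0)).elim
  have types : ∀ t ∈ B,
      (t ≤ ρ + r * ρ ∧ (t - r * lam) / ρ ∈ B ∧ (t - r * (1 - ρ)) / ρ ∈ B) ∨
      ((t - lam) / ρ ∈ B ∧ (t - r * (1 - ρ)) / ρ ∈ B ∧
        ((t - r * lam) / ρ ∈ B ∨ lam ≤ t - r * lam ∧ ρ < t - r * lam)) ∨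
      (lam + r * (1 - ρ) ≤ t ∧ (t - lam) / ρ ∈ B ∧ (t - r * lam - lam) / ρ ∈ B) := by
    intro t ht
    obtain ⟨b0, b1, b2, b3⟩ := bounds t ht
    have side : ∀ x ∈ E, -r * x + t ≤ ρ ∨ lam ≤ -r * x + t := fun x hx =>
      h.le_or_ge_of_le hab.le (ht x hx) (by nlinarith [h.nonneg x hx])
    have c01 := child t ht 0 1
    have c02 := child t ht 0 2
    have c10 := child t ht 1 0
    have c11 := child t ht 1 1
    simp only [shift_zero, shift_one, shift_two, mul_zero, zero_add, sub_zero, add_zero,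
      neg_mul, ← sub_eq_add_neg, ← sub_eq_neg_add] at *
    rcases side _ h.rho_mem with h1 | h1
    · left
      exact ⟨by linarith, c01 (by nlinarith) (by nlinarith), c02 (by linarith) (by nlinarith)⟩
    · right
      have d10 := c10 h1 b1
      rcases side _ h.one_sub_mem with h2 | h2
      · left
        refine ⟨d10, c02 (by linarith) h2, ?_⟩
        rcases le_or_gt (t - r * lam) ρ with h3 | h3
        · exact Or.inl (c01 (by nlinarith) h3)
        · rcases side _ h.lam_mem with h4 | h4
          · exact absurd h4 (by linarith)
          · exact Or.inr ⟨by linarith, by linarith⟩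
      · right
        exact ⟨by linarith, d10, c11 (by nlinarith) (by nlinarith)⟩
  have hbdd : BddAbove B := ⟨lam + ρ, fun t ht => (bounds t ht).2.1⟩
  have hbddb : BddBelow B := ⟨lam, fun t ht => (bounds t ht).1⟩
  set M := sSup B
  set m := sInf B
  have hM : ∀ t ∈ B, t ≤ M := fun t ht => le_csSup hbdd ht
  have hm : ∀ t ∈ B, m ≤ t := fun t ht => csInf_le hbddb ht
  have hMd : ∀ s, s / ρ ∈ B → s ≤ ρ * M := fun s hs => by
    have := hM _ hs
    rw [div_le_iff₀ hρ] at this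
    linarith
  have hmd : ∀ s, s / ρ ∈ B → ρ * m ≤ s := fun s hs => by
    have := hm _ hs
    rw [le_div_iff₀ hρ] at this
    linarith
  have hmM : m ≤ M := by
    obtain ⟨t, ht⟩ := hne
    exact (hm t ht).trans (hM t ht)
  have hr1ρ : 0 < r * (1 - ρ - lam) := mul_pos hr0 (by linarith)
  have hrlam : 0 < r * lam := mul_pos hr0 (by linarith)
  have hrlam1 : r * lam < lam := by nlinarith
  have hMle : (1 - ρ) * M ≤ lam := by
    by_contra hc
    push Not at hc
    obtain ⟨t, ht, hlt⟩ := exists_lt_of_lt_csSup hne (show lam + ρ * M < M by linarith)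
    rcases types t ht with ⟨-, h2, -⟩ | ⟨h2, -⟩ | ⟨-, h2, -⟩ <;> linarith [hMd _ h2]
  have hmge : r ≤ m := by
    by_contra hc
    push Not at hc
    obtain ⟨t, ht, htlt⟩ := exists_lt_of_csInf_lt hne
      (show m < min (r * (1 - ρ) + ρ * m) (lam + r * lam + ρ * m) from
        lt_min (by nlinarith) (by nlinarith))
    have u1 := htlt.trans_le (min_le_left _ _)
    have u2 := htlt.trans_le (min_le_right _ _)
    rcases types t ht with ⟨-, -, h3⟩ | ⟨-, h3, -⟩ | ⟨-, -, h3⟩ <;> linarith [hmd _ h3]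
  rcases (show r * (1 - ρ) ≤ lam by nlinarith).lt_or_eq with hlt | heq
  · have no_mid : ∀ t, (t - lam) / ρ ∈ B → (t - r * (1 - ρ)) / ρ ∈ B → False := by
      intro t h1 h2
      have e1 := hmd _ h1
      have e2 := hMd _ h2
      nlinarith
    obtain ⟨t, ht, htlt⟩ := exists_lt_of_lt_csSup hne
      (show r * lam + ρ * M < M by nlinarith)
    obtain ⟨t', ht', htlt'⟩ := exists_lt_of_csInf_lt hne
      (show m < lam + r * lam + ρ * m by nlinarith)
    have f1 : lam + r * (1 - ρ) ≤ t := by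
      rcases types t ht with ⟨-, h2, -⟩ | ⟨h1, h2, -⟩ | ⟨h1, -⟩
      · linarith [hMd _ h2]
      · exact (no_mid t h1 h2).elim
      · exact h1
    have f2 : t' - r * lam ≤ ρ * M := by
      rcases types t' ht' with ⟨-, h2, -⟩ | ⟨h1, h2, -⟩ | ⟨-, -, h2⟩
      · exact hMd _ h2
      · exact (no_mid t' h1 h2).elim
      · linarith [hmd _ h2]
    have f3 := (bounds t' ht').1
    have f4 := hM t ht
    have g1 : (1 - ρ) * (r * (1 - ρ)) ≤ ρ * lam := by nlinarith
    have g2 : (1 - ρ) * (lam - r * lam) ≤ ρ * lam := by nlinarith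
    have g3 : (1 - ρ) * (1 - r) ≤ ρ := by
      by_contra hc
      push Not at hc
      nlinarith
    have g4 : (1 - ρ) * (1 - 2 * ρ) ≤ ρ * lam := by nlinarith
    nlinarith
  · have hmM' : m = M := by nlinarith
    have hρmM : ρ * m = ρ * M := by rw [hmM']
    have huniq : ∀ s s', s / ρ ∈ B → s' / ρ ∈ B → s = s' := fun s s' hs hs' => by
      linarith [hmd _ hs, hMd _ hs, hmd _ hs', hMd _ hs']
    obtain ⟨t, ht⟩ := hne
    have htr : t = r := by nlinarith [hm t ht, hM t ht]
    rcases types t ht with ⟨-, h2, h3⟩ | ⟨h1, h2, h3 | ⟨h3, h4⟩⟩ | ⟨-, h2, h3⟩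
    · linarith [huniq _ _ h2 h3]
    · linarith [huniq _ _ h2 h3]
    · have h5 : lam ≤ ρ := by
        by_contra hc
        push Not at hc
        linarith [mul_lt_mul_of_pos_left hc hr0]
      have h6 : lam = ρ := le_antisymm h5 hl1
      subst h6
      linarith
    · linarith [huniq _ _ h2 h3]

lemma eq_of_one_le (h : IsAttractor ρ lam E) (hf : Maps E r t) (hr : 1 ≤ r) : r = 1 ∧ t = 0 := by
  have h0 := h.nonneg _ (h.maps_mem_zero hf)
  have h1 := h.le_one _ (h.maps_mem_one hf)
  constructor <;> linarith

lemma eq_of_le_neg_one (h : IsAttractor ρ lam E) (hf : Maps E r t) (hr : r ≤ -1) :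
    r = -1 ∧ t = 1 := by
  have h0 := h.le_one _ (h.maps_mem_zero hf)
  have h1 := h.nonneg _ (h.maps_mem_one hf)
  constructor <;> linarith

/-- When the right gap is longer than the left one, `E` is not symmetric. -/
lemma not_maps_neg_of_one_le (h : IsAttractor ρ lam E) (hab : 2 * lam < 1 - ρ) (hr : 1 ≤ r) :
    ¬ Maps E (-r) t := by
  intro hf
  obtain ⟨hr', rfl⟩ := h.eq_of_le_neg_one hf (by linarith)
  rw [hr'] at hf
  have hρ := h.pos; have hρ3 := h.lt_third
  obtain ⟨ε, hε, hε1, hε2⟩ := h.exists_small (show 0 < 1 - ρ - 2 * lam by linarith)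
  have h1 : ρ * ε < ε := by nlinarith
  have h2 : 0 < ρ * ε := by positivity
  have := h.le_lam
  rcases h.location (hf _ (h.mem_mid hε)) with h3 | ⟨-, h3⟩ | h3 <;> linarith

lemma isWord_of_pos (h : IsAttractor ρ lam E) (hab : 2 * lam < 1 - ρ) (hr0 : 0 < r)
    (hf : Maps E r t) : IsWord ρ lam r t := by
  have hρ := h.pos
  have main : ∀ n : ℕ, ∀ r t, ρ ^ n < r → Maps E r t → IsWord ρ lam r t := by
    intro n
    induction n with
    | zero =>
      intro r t hr hf
      rw [pow_zero] at hr
      exact absurd (h.eq_of_one_le hf hr.le).1 hr.ne'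
    | succ n ih =>
      intro r t hr hf
      have hr0 : 0 < r := (pow_pos hρ _).trans hr
      rcases lt_or_ge r 1 with hr1 | hr1
      · refine h.isWord_of_isWord_div hab hr0 hr1 (fun t => ih _ _ ?_) hf
        rwa [lt_div_iff₀ hρ, ← pow_succ]
      · obtain ⟨rfl, rfl⟩ := h.eq_of_one_le hf hr1
        exact ⟨[], fun x => by simp [compWord]⟩
  obtain ⟨n, hn⟩ := exists_pow_lt_of_lt_one hr0 (show ρ < 1 by linarith [h.lt_third])
  exact main n r t hn hf

lemma not_maps_neg (h : IsAttractor ρ lam E) (hab : 2 * lam < 1 - ρ) (hr0 : 0 < r) :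
    ¬ Maps E (-r) t := by
  have hρ := h.pos
  have main : ∀ n : ℕ, ∀ r t, ρ ^ n < r → ¬ Maps E (-r) t := by
    intro n
    induction n with
    | zero =>
      intro r t hr
      rw [pow_zero] at hr
      exact h.not_maps_neg_of_one_le hab hr.le
    | succ n ih =>
      intro r t hr
      have hr0 : 0 < r := (pow_pos hρ _).trans hr
      rcases lt_or_ge r 1 with hr1 | hr1
      · refine h.not_maps_neg_of_div hab hr0 hr1 fun t => ?_
        rw [neg_div]
        exact ih _ _ (by rwa [lt_div_iff₀ hρ, ← pow_succ])
      · exact h.not_maps_neg_of_one_le hab hr1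
  obtain ⟨n, hn⟩ := exists_pow_lt_of_lt_one hr0 (show ρ < 1 by linarith [h.lt_third])
  exact main n r t hn

lemma isWord_of_lt (h : IsAttractor ρ lam E) (hab : 2 * lam < 1 - ρ) (hr0 : r ≠ 0)
    (hf : Maps E r t) : IsWord ρ lam r t := by
  rcases hr0.lt_or_gt with hr | hr
  · exact absurd (by rwa [neg_neg]) (h.not_maps_neg (r := -r) (t := t) hab (by linarith))
  · exact h.isWord_of_pos hab hr hf

/-- The reflected attractor. -/
lemma reflect (h : IsAttractor ρ lam E) : IsAttractor ρ (1 - ρ - lam) {x | 1 - x ∈ E} := by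
  have key : ∀ i x, 1 - piece ρ (1 - ρ - lam) i x = piece ρ lam i.rev (1 - x) := by
    intro i x
    fin_cases i <;> simp [piece, Fin.rev] <;> ring
  refine ⟨h.pos, h.lt_third, by linarith [h.lam_le], by linarith [h.le_lam],
    fun x hx => by linarith [h.le_one _ hx], fun x hx => by linarith [h.nonneg _ hx],
    by simpa using h.one_mem, by simpa using h.zero_mem, fun i x hx => ?_, fun x hx => ?_⟩
  · rw [Set.mem_ofPred_eq, key]
    exact h.piece_mem _ _ hx
  · obtain ⟨i, y, hy, hxy⟩ := h.exists_piece _ hx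
    refine ⟨i.rev, 1 - y, by simpa using hy, ?_⟩
    have := key i.rev (1 - y)
    rw [Fin.rev_rev, sub_sub_cancel] at this
    linarith

end IsAttractor

lemma IsWord.of_reflect {ρ lam r t : ℝ} (h : IsWord ρ (1 - ρ - lam) r (1 - r - t)) :
    IsWord ρ lam r t := by
  have key : ∀ i x, piece ρ lam (Fin.rev i) (1 - x) = 1 - piece ρ (1 - ρ - lam) i x := by
    intro i x
    fin_cases i <;> simp [piece, Fin.rev] <;> ring
  have hword : ∀ (w : List (Fin 3)) (x : ℝ), compWord (piece ρ lam) (w.map Fin.rev) (1 - x) =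
      1 - compWord (piece ρ (1 - ρ - lam)) w x := by
    intro w x
    induction w with
    | nil => rfl
    | cons i w ih => rw [List.map_cons, compWord_cons, compWord_cons, ih, key]
  obtain ⟨w, hw⟩ := h
  refine ⟨w.map Fin.rev, fun x => ?_⟩
  have := hword w (1 - x)
  rw [← hw, sub_sub_cancel] at this
  rw [this]
  ring

namespace IsAttractor

variable {ρ lam r t : ℝ} {E : Set ℝ}

lemma isWord_of_gt (h : IsAttractor ρ lam E) (hab : 1 - ρ < 2 * lam) (hr0 : r ≠ 0)
    (hf : Maps E r t) : IsWord ρ lam r t := by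
  refine IsWord.of_reflect (h.reflect.isWord_of_lt (by linarith) hr0 fun x hx => ?_)
  have := hf _ hx
  rw [Set.mem_ofPred_eq]
  convert this using 1
  ring

/-- When the two gaps are equal, a contraction preserving `E` maps it into a single piece. -/
lemma exists_maps_div (h : IsAttractor ρ lam E) (hab : 2 * lam = 1 - ρ) (hr0 : r ≠ 0)
    (hr1 : |r| < 1) (hf : Maps E r t) :
    ∃ i, Maps E (r / ρ) ((t - shift ρ lam i) / ρ) := by
  have h00 := h.nonneg _ (h.maps_mem_zero hf)
  have h01 := h.le_one _ (h.maps_mem_zero hf)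
  have h10 := h.nonneg _ (h.maps_mem_one hf)
  have h11 := h.le_one _ (h.maps_mem_one hf)
  have := h.lt_third
  rcases h.last_or_first_two hab.le hf hr0 hr1 with ⟨h1, h2⟩ | ⟨h1, h2⟩
  · rcases h.not_straddle hab.le hf hr0 hr1 (p := ρ) (q := lam) (by linarith)
      (fun x hx hc => by rcases h.location hx with h' | h' | h' <;> linarith [h.pos])
      with ⟨h3, h4⟩ | ⟨h3, h4⟩
    · exact ⟨0, h.maps_div hf 0 (by simp [*]) (by simp [*])⟩
    · exact ⟨1, h.maps_div hf 1 (by simp [*]) (by simp [*])⟩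
  · exact ⟨2, h.maps_div hf 2 (by simp [*]) (by simp [*])⟩

lemma exists_word_of_eq (h : IsAttractor ρ lam E) (hab : 2 * lam = 1 - ρ) (hr0 : r ≠ 0)
    (hf : Maps E r t) : ∃ w : List (Fin 3), (∀ x, r * x + t = compWord (piece ρ lam) w x) ∨
      (∀ x, r * x + t = compWord (piece ρ lam) w (1 - x)) := by
  have hρ := h.pos
  have main : ∀ n : ℕ, ∀ r t, ρ ^ n ≤ |r| → Maps E r t →
      ∃ w : List (Fin 3), (∀ x, r * x + t = compWord (piece ρ lam) w x) ∨
        (∀ x, r * x + t = compWord (piece ρ lam) w (1 - x)) := by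
    intro n
    induction n with
    | zero =>
      intro r t hr hf
      rw [pow_zero] at hr
      rcases le_abs.1 hr with hr | hr
      · obtain ⟨rfl, rfl⟩ := h.eq_of_one_le hf hr
        exact ⟨[], Or.inl fun x => by simp [compWord]⟩
      · obtain ⟨rfl, rfl⟩ := h.eq_of_le_neg_one hf (by linarith)
        exact ⟨[], Or.inr fun x => by simp only [compWord, List.foldr_nil, id]; ring⟩
    | succ n ih =>
      intro r t hr hf
      rcases le_or_gt (ρ ^ n) |r| with hn | hn
      · exact ih r t hn hf
      have hr0 : r ≠ 0 := abs_pos.1 ((pow_pos hρ _).trans_le hr)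
      obtain ⟨i, hi⟩ := h.exists_maps_div hab hr0
        (hn.trans_le (pow_le_one₀ hρ.le (by linarith [h.lt_third]))) hf
      obtain ⟨w, hw⟩ := ih _ _ (by rwa [abs_div, abs_of_pos hρ, le_div_iff₀ hρ, ← pow_succ]) hi
      have key : ∀ x, r * x + t = piece ρ lam i (r / ρ * x + (t - shift ρ lam i) / ρ) :=
        fun x => by unfold piece; field_simp; ring
      refine ⟨i :: w, hw.imp (fun hw x => ?_) fun hw x => ?_⟩ <;>
        rw [compWord_cons, ← hw, key]
  obtain ⟨n, hn⟩ := exists_pow_lt_of_lt_one (abs_pos.2 hr0)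
    (show ρ < 1 by linarith [h.lt_third])
  exact main n r t hn.le hf

end IsAttractor

/-- The nonempty compact set invariant under the three similarities has convex hull `[0,1]`. -/
lemma isAttractor_of_isCompact {ρ lam : ℝ} {E : Set ℝ} (hρ0 : 0 < ρ) (hρ3 : ρ < 1 / 3)
    (hl1 : ρ ≤ lam) (hl2 : lam ≤ 1 - 2 * ρ) (hEc : IsCompact E) (hEne : E.Nonempty)
    (hE : E = piece ρ lam 0 '' E ∪ piece ρ lam 1 '' E ∪ piece ρ lam 2 '' E) :
    IsAttractor ρ lam E := by
  have hex : ∀ x ∈ E, ∃ i, ∃ y ∈ E, x = piece ρ lam i y := by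
    intro x hx
    rw [hE] at hx
    rcases hx with (⟨y, hy, rfl⟩ | ⟨y, hy, rfl⟩) | ⟨y, hy, rfl⟩
    exacts [⟨0, y, hy, rfl⟩, ⟨1, y, hy, rfl⟩, ⟨2, y, hy, rfl⟩]
  have hmem : ∀ i, ∀ x ∈ E, piece ρ lam i x ∈ E := by
    intro i x hx
    rw [hE]
    fin_cases i
    exacts [Or.inl (Or.inl ⟨x, hx, rfl⟩), Or.inl (Or.inr ⟨x, hx, rfl⟩), Or.inr ⟨x, hx, rfl⟩]
  have hs : ∀ i, 0 ≤ shift ρ lam i ∧ shift ρ lam i ≤ 1 - ρ := by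
    intro i
    fin_cases i <;> simp <;> (try constructor) <;> linarith
  obtain ⟨M, hM, hMu⟩ := hEc.exists_isGreatest hEne
  obtain ⟨m, hm, hml⟩ := hEc.exists_isLeast hEne
  have hM1 : M ≤ 1 := by
    obtain ⟨i, y, hy, hiy⟩ := hex M hM
    have := hMu hy
    have := (hs i).2
    unfold piece at hiy
    nlinarith
  have hm0 : 0 ≤ m := by
    obtain ⟨i, y, hy, hiy⟩ := hex m hm
    have := hml hy
    have := (hs i).1
    unfold piece at hiy
    nlinarith
  have hM1' : M = 1 := by
    have := hMu (hmem 2 M hM)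
    simp only [piece, shift_two] at this
    nlinarith
  have hm0' : m = 0 := by
    have := hml (hmem 0 m hm)
    simp only [piece, shift_zero] at this
    nlinarith
  subst hM1' hm0'
  exact ⟨hρ0, hρ3, hl1, hl2, fun x hx => hml hx, fun x hx => hMu hx, hm, hM, hmem, hex⟩

end ThreePiece

theorem main_theorem (ρ lam r t : ℝ) (E : Set ℝ)
    (hρ0 : 0 < ρ) (hρ3 : ρ < 1 / 3) (hl1 : ρ ≤ lam) (hl2 : lam ≤ 1 - 2 * ρ)
    (hEc : IsCompact E) (hEne : E.Nonempty)
    (φ : Fin 3 → ℝ → ℝ)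
    (hφ0 : ∀ x, φ 0 x = ρ * x) (hφ1 : ∀ x, φ 1 x = ρ * x + lam)
    (hφ2 : ∀ x, φ 2 x = ρ * x + (1 - ρ))
    (hE : E = φ 0 '' E ∪ φ 1 '' E ∪ φ 2 '' E)
    (hr0 : 0 < |r|) (hr1 : |r| < 1)
    (hf : (fun x : ℝ => r * x + t) '' E ⊆ E) :
    (lam ≠ (1 - ρ) / 2 →
      ∃ w : List (Fin 3), ∀ x : ℝ, r * x + t = compWord φ w x) ∧
    (lam = (1 - ρ) / 2 →
      ∃ w : List (Fin 3),
        (∀ x : ℝ, r * x + t = compWord φ w x) ∨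
        (∀ x : ℝ, r * x + t = compWord φ w (1 - x))) := by
  have hφ : φ = ThreePiece.piece ρ lam := by
    funext i x
    fin_cases i
    · simpa [ThreePiece.piece] using hφ0 x
    · simpa [ThreePiece.piece] using hφ1 x
    · simpa [ThreePiece.piece] using hφ2 x
  subst hφ
  have h := ThreePiece.isAttractor_of_isCompact hρ0 hρ3 hl1 hl2 hEc hEne hE
  have hmaps : ThreePiece.Maps E r t := fun x hx => hf ⟨x, hx, rfl⟩
  have hr : r ≠ 0 := abs_pos.1 hr0
  refine ⟨fun hne => ?_, fun heq => h.exists_word_of_eq (by linarith) hr hmaps⟩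
  rcases hne.lt_or_gt with hlt | hgt
  · exact h.isWord_of_lt (by linarith) hr hmaps
  · exact h.isWord_of_gt (by linarith) hr hmaps
end
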